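/- arXiv:2404.12906 — 7 statements merged into one kernel-verified Lean document; each statement's English description precedes it below -/
import Mathlib

section
/- The Diophantine equation x² + (x+1)² = w⁴ has exactly two solutions in non-negative integers x and w, namely (x, w) = (0, 1) and (x, w) = (119, 13). -/
open Polynomial

noncomputable def Phi (r : ℕ) (e : ℂ) : ℂ[X] →ₗ[ℂ] ℂ :=
  Polynomial.lsum fun n => (e ^ ((n : ℤ) - r) / (4 * ((n : ℂ) - r) + 1)) • LinearMap.id

lemma den_ne (n r : ℕ) : (4 * ((n : ℂ) - r) + 1) ≠ 0 := by
  have : (4 * ((n : ℤ) - r) + 1) ≠ 0 := by omega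
  exact_mod_cast this

lemma Phi_monomial (r : ℕ) (e : ℂ) (n : ℕ) (a : ℂ) :
    Phi r e (monomial n a) = e ^ ((n : ℤ) - r) / (4 * ((n : ℂ) - r) + 1) * a := by
  simp [Phi, Polynomial.lsum_apply]

lemma Phi_delta (r : ℕ) (e : ℂ) (he : e ≠ 0) (F : ℂ[X]) :
    Phi r e (4 * X * derivative F + C (1 - 4 * (r : ℂ)) * F) = e ^ (-(r : ℤ)) * F.eval e := by
  induction F using Polynomial.induction_on' with
  | add p q hp hq =>
    have : 4 * X * derivative (p + q) + C (1 - 4 * (r : ℂ)) * (p + q) =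
      (4 * X * derivative p + C (1 - 4 * (r : ℂ)) * p) +
      (4 * X * derivative q + C (1 - 4 * (r : ℂ)) * q) := by
      rw [derivative_add]; ring
    rw [this, map_add, hp, hq, eval_add]; ring
  | monomial n a =>
    have : 4 * X * derivative (monomial n a) + C (1 - 4 * (r : ℂ)) * (monomial n a) =
        monomial n ((4 * ((n : ℂ) - r) + 1) * a) := by
      rw [derivative_monomial]
      cases n with
      | zero => simp [sub_eq_neg_add]
      | succ k =>
        have h4 : (4 : ℂ[X]) = C 4 := (map_ofNat C 4).symm
        have h5 (z a : ℂ) : C z * monomial (k + 1) a = monomial (k + 1) (z * a) := C_mul_monomial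
        rw [h5, h4, mul_assoc, X_mul_monomial, C_mul_monomial]
        simp only [Nat.add_sub_cancel]
        rw [← map_add]
        congr 1; push_cast; ring
    rw [this, Phi_monomial, eval_monomial]
    have := den_ne n r
    rw [zpow_sub₀ he, zpow_neg]
    field_simp
    simp [mul_comm]

lemma Phi_shift (r : ℕ) (e : ℂ) (F : ℂ[X]) : Phi (r + 1) e (X * F) = Phi r e F := by
  induction F using Polynomial.induction_on' with
  | add p q hp hq => rw [mul_add, map_add, map_add, hp, hq]
  | monomial n a =>
    rw [X_mul_monomial, Phi_monomial, Phi_monomial]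
    push_cast
    simp

noncomputable def qq (c : ℂ) : ℂ[X] := (X - C c) * (1 - X)

noncomputable def LL (c e : ℂ) (r : ℕ) : ℂ := Phi r e (qq c ^ r)

lemma LL_zero (c e : ℂ) : LL c e 0 = 1 := by
  have := Phi_monomial 0 e 0 1
  simpa [LL] using this

lemma LL_one (c e : ℂ) (he : e ≠ 0) : LL c e 1 = -e / 5 + (1 + c) + c / e / 3 := by
  have : qq c ^ 1 = monomial 2 (-1) + monomial 1 (1 + c) + monomial 0 (-c) := by
    simp only [qq, ← C_mul_X_pow_eq_monomial]
    simp
    ring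
  rw [LL, this, map_add, map_add, Phi_monomial, Phi_monomial, Phi_monomial]
  norm_num
  field_simp

lemma LL_rec (c e : ℂ) (he : e ≠ 0) (hq : (qq c).eval e = 0) (s : ℕ) :
    LL c e (s + 2) * (16 * ((s : ℂ) + 2) ^ 2 - 1) =
      4 * ((s : ℂ) + 2) * (4 * (2 * s + 3) * (1 + c) * LL c e (s + 1)
        - 4 * (s + 1) * (1 - c) ^ 2 * LL c e s) := by
  have h := Phi_delta (s + 2) e he
    (qq c ^ (s + 1) * (C (4 * ((s : ℂ) + 2)) * (C c - X ^ 2) - qq c))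
  have h0 : (qq c ^ (s + 1) * (C (4 * ((s : ℂ) + 2)) * (C c - X ^ 2) - qq c)).eval e = 0 := by
    simp [hq]
  rw [h0, mul_zero] at h
  have key : 4 * X * derivative (qq c ^ (s + 1) * (C (4 * ((s : ℂ) + 2)) * (C c - X ^ 2) - qq c))
      + C (1 - 4 * ((s + 2 : ℕ) : ℂ)) * (qq c ^ (s + 1) * (C (4 * ((s : ℂ) + 2)) * (C c - X ^ 2) - qq c))
      = C (16 * ((s : ℂ) + 2) ^ 2 - 1) * qq c ^ (s + 2)
        - C (4 * ((s : ℂ) + 2) * (4 * (2 * s + 3) * (1 + c))) * (X * qq c ^ (s + 1))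
        + C (4 * ((s : ℂ) + 2) * (4 * (s + 1) * (1 - c) ^ 2)) * (X * (X * qq c ^ s)) := by
    have hd : derivative (qq c) = C (1 + c) - 2 * X := by
      simp [qq]; ring
    rw [derivative_mul, derivative_pow_succ]
    simp only [derivative_sub, derivative_mul, derivative_C, derivative_X_pow, hd]
    have hqq : qq c = (X - C c) * (1 - X) := rfl
    simp only [pow_succ (qq c)]
    generalize qq c ^ s = W
    rw [hqq]
    have h2 : (C 2 : ℂ[X]) = 2 := map_ofNat C 2
    have h3 : (C 3 : ℂ[X]) = 3 := map_ofNat C 3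
    have h4 : (C 4 : ℂ[X]) = 4 := map_ofNat C 4
    have h16 : (C 16 : ℂ[X]) = 16 := map_ofNat C 16
    simp [h2, h3, h4, h16]
    ring
  rw [key, map_add, map_sub, ← smul_eq_C_mul, ← smul_eq_C_mul, ← smul_eq_C_mul, map_smul, map_smul,
    map_smul, Phi_shift, Phi_shift, Phi_shift] at h
  simp only [smul_eq_mul] at h
  change _ * LL c e (s + 2) - _ * LL c e (s + 1) + _ * LL c e s = 0 at h
  linear_combination h

def PP (s : ℤ) (n : ℕ) : ℤ := ∏ i ∈ Finset.range n, (4 * (s + i) + 1)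

lemma PP_ne (s : ℤ) (n : ℕ) : PP s n ≠ 0 := by
  unfold PP
  refine Finset.prod_ne_zero_iff.mpr fun i _ => ?_
  omega

lemma PP_add (s : ℤ) (n m : ℕ) : PP s (n + m) = PP s n * PP (s + n) m := by
  unfold PP
  rw [Finset.prod_range_add]
  congr 1
  refine Finset.prod_congr rfl fun i _ => ?_
  push_cast; ring

lemma fact_dvd_PP (s : ℤ) (n : ℕ) : (n.factorial : ℤ) ∣ 2 ^ n * PP s n := by
  obtain ⟨v, m, hm, hv⟩ := Nat.exists_eq_two_pow_mul_odd (n := n.factorial) (Nat.factorial_ne_zero n)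
  have hvn : v ≤ n := by
    have h1 := padicValNat_factorial_le (p := 2) n
    refine le_trans ?_ h1
    rw [← padicValNat_dvd_iff_le (p := 2) (Nat.factorial_ne_zero n)]
    exact ⟨m, hv⟩
  have hmP : (m : ℤ) ∣ PP s n := by
    have hcop : IsCoprime (4 : ℤ) (m : ℤ) := by
      have : Nat.Coprime (2 ^ 2) m := Nat.Coprime.pow_left 2 (Nat.coprime_two_left.mpr hm)
      exact_mod_cast Nat.isCoprime_iff_coprime.mpr this
    obtain ⟨a, b, hab⟩ := hcop
    have hmod : PP s n ≡ ∏ i ∈ Finset.range n, (4 * ((s + a) + i)) [ZMOD m] := by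
      unfold PP
      refine Int.ModEq.prod fun i _ => ?_
      refine (Int.modEq_iff_dvd.mpr ⟨-b, ?_⟩)
      linear_combination hab
    have hd : (m : ℤ) ∣ ∏ i ∈ Finset.range n, (4 * ((s + a) + i)) := by
      rw [Finset.prod_mul_distrib]
      refine Dvd.dvd.mul_left ?_ _
      refine dvd_trans ?_ (Nat.factorial_coe_dvd_prod n (s + a))
      rw [hv]; push_cast; exact Dvd.intro_left _ rfl
    exact (Int.ModEq.dvd_iff hmod).mpr hd
  rw [hv]; push_cast
  exact mul_dvd_mul (pow_dvd_pow 2 hvn) hmP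

lemma S_formula (r : ℕ) : ∀ y : ℂ, (∀ k : ℕ, 4 * (k : ℂ) + y ≠ 0) →
    ∑ k ∈ Finset.range (r + 1), (-1) ^ k * (r.choose k : ℂ) / (4 * k + y) =
      4 ^ r * r.factorial / ∏ k ∈ Finset.range (r + 1), (4 * (k : ℂ) + y) := by
  induction r with
  | zero => intro y hy; simp
  | succ r ih =>
    intro y hy
    have hy' : ∀ k : ℕ, 4 * (k : ℂ) + (y + 4) ≠ 0 := by
      intro k; have := hy (k + 1); push_cast at this
      intro h; apply this; linear_combination h
    have e1 := ih y hy
    have e2 := ih (y + 4) hy'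
    have hs : ∑ k ∈ Finset.range (r + 1 + 1), (-1) ^ k * ((r + 1).choose k : ℂ) / (4 * k + y) =
        ∑ k ∈ Finset.range (r + 1), (-1) ^ k * (r.choose k : ℂ) / (4 * k + y) -
        ∑ k ∈ Finset.range (r + 1), (-1) ^ k * (r.choose k : ℂ) / (4 * k + (y + 4)) := by
      have e3 : ∑ k ∈ Finset.range (r + 1), (-1) ^ k * (r.choose k : ℂ) / (4 * k + y) =
          ∑ k ∈ Finset.range (r + 1 + 1), (-1) ^ k * (r.choose k : ℂ) / (4 * k + y) := by
        rw [Finset.sum_range_succ _ (r + 1)]; simp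
      rw [e3, Finset.sum_range_succ' _ (r + 1), Finset.sum_range_succ' _ (r + 1)]
      have : ∀ k ∈ Finset.range (r + 1), (-1) ^ (k + 1) * ((r + 1).choose (k + 1) : ℂ) / (4 * ((k + 1 : ℕ) : ℂ) + y)
         = (-1) ^ (k + 1) * (r.choose (k + 1) : ℂ) / (4 * ((k + 1 : ℕ) : ℂ) + y) - (-1) ^ k * (r.choose k : ℂ) / (4 * k + (y + 4)) := by
        intro k _
        rw [Nat.choose_succ_succ]
        have : (4 * ((k + 1 : ℕ) : ℂ) + y) = 4 * k + (y + 4) := by push_cast; ring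
        rw [this]
        push_cast; ring
      rw [Finset.sum_congr rfl this, Finset.sum_sub_distrib]
      simp; ring
    rw [hs, e1, e2]
    have p1 : ∏ k ∈ Finset.range (r + 1 + 1), (4 * (k : ℂ) + y) =
        (∏ k ∈ Finset.range (r + 1), (4 * (k : ℂ) + y)) * (4 * (r + 1) + y) := by
      rw [Finset.prod_range_succ]; push_cast; rfl
    have p2 : ∏ k ∈ Finset.range (r + 1 + 1), (4 * (k : ℂ) + y) =
        (∏ k ∈ Finset.range (r + 1), (4 * (k : ℂ) + (y + 4))) * y := by
      rw [Finset.prod_range_succ']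
      congr 1
      · refine Finset.prod_congr rfl fun k _ => ?_
        push_cast; ring
      · simp
    have n1 : ∏ k ∈ Finset.range (r + 1), (4 * (k : ℂ) + y) ≠ 0 :=
      Finset.prod_ne_zero_iff.mpr fun k _ => hy k
    have n2 : ∏ k ∈ Finset.range (r + 1), (4 * (k : ℂ) + (y + 4)) ≠ 0 :=
      Finset.prod_ne_zero_iff.mpr fun k _ => hy' k
    have n3 : y ≠ 0 := by simpa using hy 0
    have n4 : 4 * ((r : ℂ) + 1) + y ≠ 0 := by simpa using hy (r + 1)
    rw [p1] at p2 ⊢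
    rw [Nat.factorial_succ]
    generalize ∏ k ∈ Finset.range (r + 1), (4 * (k : ℂ) + y) = U at *
    generalize ∏ k ∈ Finset.range (r + 1), (4 * (k : ℂ) + (y + 4)) = V at *
    have hV : V = U * (4 * (r + 1) + y) / y := by field_simp; linear_combination -p2
    rw [hV]
    field_simp
    push_cast
    ring

noncomputable def SS (r m : ℕ) : ℂ :=
  ∑ k ∈ Finset.range (r + 1), (-1) ^ k * (r.choose k : ℂ) / (4 * ((k : ℂ) - m) + 1)

lemma SS_eq (r m : ℕ) : SS r m = 4 ^ r * r.factorial / (PP (-m) (r + 1) : ℂ) := by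
  have h := S_formula r (1 - 4 * (m : ℂ)) (by
    intro k; have := den_ne k m; intro h; apply this; linear_combination h)
  unfold SS PP
  push_cast
  have e1 : ∀ k : ℕ, 4 * ((k : ℂ) - m) + 1 = 4 * k + (1 - 4 * (m : ℂ)) := fun k => by ring
  have e2 : ∀ k : ℕ, 4 * (-(m : ℂ) + k) + 1 = 4 * k + (1 - 4 * (m : ℂ)) := fun k => by ring
  simp only [e1, e2]
  exact h

noncomputable def nu (r : ℕ) : ℂ := 2 ^ r * (PP (-r) (2 * r + 1) : ℂ) / (4 ^ r * (r.factorial : ℂ) ^ 2)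

lemma nu_zero : nu 0 = 1 := by simp [nu, PP]

lemma nu_succ (r : ℕ) : nu (r + 1) = nu r * ((1 - 16 * ((r : ℂ) + 1) ^ 2) / (2 * ((r : ℂ) + 1) ^ 2)) := by
  have h : PP (-((r + 1 : ℕ) : ℤ)) (2 * (r + 1) + 1) = (1 - 16 * ((r : ℤ) + 1) ^ 2) * PP (-r) (2 * r + 1) := by
    have e : 2 * (r + 1) + 1 = 1 + (2 * r + 1) + 1 := by ring
    rw [e, PP_add, PP_add]
    have e2 : (-((r + 1 : ℕ) : ℤ)) + (1 : ℕ) = - r := by push_cast; ring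
    rw [e2]
    simp [PP]
    ring
  unfold nu
  rw [h, Nat.factorial_succ]
  have h1 : ((r : ℂ) + 1) ≠ 0 := by exact_mod_cast Nat.succ_ne_zero r
  have h2 : (r.factorial : ℂ) ≠ 0 := by exact_mod_cast Nat.factorial_ne_zero r
  push_cast
  field_simp
  ring

lemma nu_ne (r : ℕ) : nu r ≠ 0 := by
  unfold nu
  have h2 : (r.factorial : ℂ) ≠ 0 := by exact_mod_cast Nat.factorial_ne_zero r
  have h3 : (PP (-r) (2 * r + 1) : ℂ) ≠ 0 := by exact_mod_cast PP_ne _ _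
  refine div_ne_zero (mul_ne_zero (pow_ne_zero _ (by norm_num)) h3) (mul_ne_zero (pow_ne_zero _ (by norm_num)) (pow_ne_zero _ h2))

lemma coef_int (r m : ℕ) (hm : m ≤ r) : ∃ N : ℤ, nu r * ((r.choose m : ℂ) * SS r m) = N := by
  obtain ⟨a, ha⟩ := fact_dvd_PP (-r) (r - m)
  obtain ⟨b, hb⟩ := fact_dvd_PP (r - m + 1) m
  refine ⟨a * b, ?_⟩
  have hsplit : PP (-r) (2 * r + 1) = PP (-r) (r - m) * PP (-m) (r + 1) * PP (r - m + 1) m := by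
    have e : 2 * r + 1 = (r - m) + (r + 1) + m := by omega
    rw [e, PP_add, PP_add]
    have e1 : (-(r : ℤ) + ((r - m : ℕ) : ℤ)) = - m := by push_cast [hm]; ring
    have e2 : (-(r : ℤ) + ((r - m + (r + 1) : ℕ) : ℤ)) = r - m + 1 := by push_cast [hm]; ring
    rw [e1, e2]
  have hch : (r.choose m : ℂ) * m.factorial * (r - m).factorial = r.factorial := by
    exact_mod_cast Nat.choose_mul_factorial_mul_factorial hm
  rw [SS_eq]
  unfold nu
  rw [hsplit]
  have h1 : (r.factorial : ℂ) ≠ 0 := by exact_mod_cast Nat.factorial_ne_zero r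
  have h2 : (m.factorial : ℂ) ≠ 0 := by exact_mod_cast Nat.factorial_ne_zero m
  have h3 : ((r - m).factorial : ℂ) ≠ 0 := by exact_mod_cast Nat.factorial_ne_zero (r - m)
  have h4 : (PP (-m) (r + 1) : ℂ) ≠ 0 := by exact_mod_cast PP_ne _ _
  have ha' : (2 : ℂ) ^ (r - m) * (PP (-r) (r - m) : ℂ) = (r - m).factorial * a := by exact_mod_cast ha
  have hb' : (2 : ℂ) ^ m * (PP (r - m + 1) m : ℂ) = m.factorial * b := by exact_mod_cast hb
  have h2r : (2 : ℂ) ^ r = 2 ^ (r - m) * 2 ^ m := by rw [← pow_add]; congr 1; omega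
  push_cast
  rw [h2r]
  have hch' : (r.choose m : ℂ) = r.factorial / (m.factorial * (r - m).factorial) := by
    field_simp; linear_combination hch
  rw [hch']
  field_simp
  linear_combination (2 : ℂ) ^ m * (PP (r - m + 1) m : ℂ) * ha' + (r - m).factorial * a * hb'

lemma LL_double (c e : ℂ) (r : ℕ) : LL c e r = ∑ m ∈ Finset.range (r + 1), ∑ k ∈ Finset.range (r + 1),
    (r.choose m : ℂ) * (-c) ^ m * ((-1) ^ k * (r.choose k : ℂ) / (4 * ((k : ℂ) - m) + 1)) * e ^ ((k : ℤ) - m) := by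
  have hq : qq c ^ r = ∑ m ∈ Finset.range (r + 1), ∑ k ∈ Finset.range (r + 1),
      monomial (r - m + k) ((r.choose m : ℂ) * (-c) ^ m * ((-1) ^ k * (r.choose k : ℂ))) := by
    rw [qq, mul_pow]
    have e1 : (X - C c : ℂ[X]) ^ r = ∑ m ∈ Finset.range (r + 1), monomial (r - m) ((r.choose m : ℂ) * (-c) ^ m) := by
      rw [sub_eq_neg_add, add_pow]
      refine Finset.sum_congr rfl fun m _ => ?_
      rw [← C_mul_X_pow_eq_monomial]
      simp; ring
    have e2 : (1 - X : ℂ[X]) ^ r = ∑ k ∈ Finset.range (r + 1), monomial k ((-1) ^ k * (r.choose k : ℂ)) := by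
      rw [sub_eq_neg_add, add_pow]
      refine Finset.sum_congr rfl fun m _ => ?_
      rw [← C_mul_X_pow_eq_monomial]
      simp [neg_pow (X : ℂ[X])]; ring
    rw [e1, e2, Finset.sum_mul_sum]
    refine Finset.sum_congr rfl fun m _ => Finset.sum_congr rfl fun k _ => ?_
    rw [monomial_mul_monomial]
  rw [LL, hq, map_sum]
  refine Finset.sum_congr rfl fun m hm => ?_
  rw [map_sum]
  refine Finset.sum_congr rfl fun k _ => ?_
  have hm' : m ≤ r := by simp at hm; omega
  rw [Phi_monomial]
  have e1 : (((r - m + k : ℕ) : ℤ) - r) = (k : ℤ) - m := by push_cast [hm']; ring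
  have e2 : (((r - m + k : ℕ) : ℂ) - r) = (k : ℂ) - m := by push_cast [hm']; ring
  rw [e1, e2]
  ring

lemma LL_A (c : ℂ) (r : ℕ) : LL c 1 r = ∑ m ∈ Finset.range (r + 1), (-c) ^ m * ((r.choose m : ℂ) * SS r m) := by
  rw [LL_double]
  refine Finset.sum_congr rfl fun m _ => ?_
  rw [SS, Finset.mul_sum, Finset.mul_sum]
  refine Finset.sum_congr rfl fun k _ => ?_
  simp; ring

lemma LL_B (c : ℂ) (hc : c ≠ 0) (r : ℕ) :
    LL c c r = ∑ k ∈ Finset.range (r + 1), (-1) ^ r * (-c) ^ k * ((r.choose (r - k) : ℂ) * SS r (r - k)) := by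
  rw [LL_double, Finset.sum_comm]
  refine Finset.sum_congr rfl fun k hk => ?_
  have hk' : k ≤ r := by simp at hk; omega
  rw [Nat.choose_symm hk', SS, ← Finset.sum_range_reflect, Finset.mul_sum, Finset.mul_sum]
  refine Finset.sum_congr rfl fun m hm => ?_
  have hm' : m ≤ r := by simp at hm; omega
  have e0 : r + 1 - 1 - m = r - m := by omega
  rw [e0, Nat.choose_symm hm']
  have e1 : 4 * ((k : ℂ) - ((r - m : ℕ) : ℂ)) + 1 = 4 * ((m : ℂ) - ((r - k : ℕ) : ℂ)) + 1 := by
    push_cast [hm', hk']; ring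
  rw [e1, zpow_sub₀ hc]
  have e2 : (-1 : ℂ) ^ (r - m) = (-1) ^ r * (-1) ^ m := by
    rw [← pow_add]
    apply neg_one_pow_congr
    grind
  rw [neg_pow c (r - m), neg_pow c k, e2]
  have hcm : c ^ (r - m) ≠ 0 := pow_ne_zero _ hc
  simp only [zpow_natCast]
  field_simp

noncomputable def cc : ℂ := (239 - Complex.I) / (239 + Complex.I)

lemma d_ne : (239 + Complex.I : ℂ) ≠ 0 := by
  intro h; have := congrArg Complex.re h; norm_num at this

lemma d_ne' : (239 - Complex.I : ℂ) ≠ 0 := by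
  intro h; have := congrArg Complex.re h; norm_num at this

lemma cc_ne : cc ≠ 0 := div_ne_zero d_ne' d_ne

lemma norm_d : ‖(239 + Complex.I : ℂ)‖ ^ 2 = 57122 := by
  rw [← Complex.normSq_eq_norm_sq]; norm_num [Complex.normSq_apply]

lemma norm_d' : ‖(239 - Complex.I : ℂ)‖ ^ 2 = 57122 := by
  rw [← Complex.normSq_eq_norm_sq]; norm_num [Complex.normSq_apply]

lemma norm_d_le : ‖(239 + Complex.I : ℂ)‖ ≤ 239.01 := by
  have := norm_d
  nlinarith [norm_nonneg (239 + Complex.I : ℂ)]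

lemma norm_cc : ‖cc‖ = 1 := by
  have h1 := norm_d; have h2 := norm_d'
  have : ‖cc‖ ^ 2 = 1 := by rw [cc, norm_div, div_pow, h1, h2]; norm_num
  nlinarith [norm_nonneg cc]

lemma one_sub_cc : 1 - cc = 2 * Complex.I / (239 + Complex.I) := by
  have := d_ne
  rw [cc]; field_simp; ring

lemma norm_one_sub_cc : ‖1 - cc‖ ^ 2 ≤ 1 / 14000 := by
  rw [one_sub_cc, norm_div, div_pow, norm_d]
  norm_num

lemma one_sub_cc_ne : 1 - cc ≠ 0 := by
  rw [one_sub_cc]; exact div_ne_zero (by simp) d_ne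

lemma qq_eval_one (c : ℂ) : (qq c).eval 1 = 0 := by simp [qq]
lemma qq_eval_c (c : ℂ) : (qq c).eval c = 0 := by simp [qq]

lemma tilde_rec (c e : ℂ) (he : e ≠ 0) (hq : (qq c).eval e = 0) (s : ℕ) :
    nu (s + 2) * LL c e (s + 2) =
      -((8 * (2 * (s : ℂ) + 3) / ((s : ℂ) + 2)) * (1 + c) * (nu (s + 1) * LL c e (s + 1))) +
      (4 * (1 - 16 * ((s : ℂ) + 1) ^ 2) / (((s : ℂ) + 2) * ((s : ℂ) + 1))) * (1 - c) ^ 2 * (nu s * LL c e s) := by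
  have h := LL_rec c e he hq s
  have h1 := nu_succ (s + 1)
  have h0 := nu_succ s
  rw [show s + 1 + 1 = s + 2 from rfl] at h1
  have n1 : (s : ℂ) + 1 ≠ 0 := by exact_mod_cast Nat.succ_ne_zero s
  have n2 : (s : ℂ) + 2 ≠ 0 := by exact_mod_cast Nat.succ_ne_zero (s + 1)
  push_cast at h1
  have e2 : (s : ℂ) + 1 + 1 = s + 2 := by ring
  rw [e2] at h1
  have : nu (s + 2) * LL c e (s + 2) = - nu (s + 1) / (2 * ((s : ℂ) + 2) ^ 2) * (LL c e (s + 2) * (16 * ((s : ℂ) + 2) ^ 2 - 1)) := by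
    rw [h1]; field_simp; ring
  rw [this, h, h0]
  field_simp
  ring

lemma tilde_bound (e : ℂ) (he : e ≠ 0) (hq : (qq cc).eval e = 0) (h1 : ‖LL cc e 1‖ ≤ 4) (r : ℕ) :
    ‖nu r * LL cc e r‖ ≤ 33 ^ r := by
  induction r using Nat.twoStepInduction with
  | zero => simp [nu_zero, LL_zero]
  | one =>
    have : nu 1 = -15 / 2 := by
      have := nu_succ 0
      norm_num [nu_zero] at this
      rw [this]; norm_num
    rw [this, norm_mul]
    norm_num
    linarith
  | more s ih0 ih1 =>
    rw [tilde_rec cc e he hq s]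
    refine (norm_add_le _ _).trans ?_
    rw [norm_neg, norm_mul, norm_mul, norm_mul (_ * _), norm_mul (_ / _), norm_pow]
    have hs : (0 : ℝ) ≤ s := Nat.cast_nonneg s
    have b1 : ‖(8 * (2 * (s : ℂ) + 3) / ((s : ℂ) + 2))‖ ≤ 16 := by
      have : (8 * (2 * (s : ℂ) + 3) / ((s : ℂ) + 2)) = ((8 * (2 * (s : ℝ) + 3) / ((s : ℝ) + 2) : ℝ) : ℂ) := by
        push_cast; rfl
      rw [this, Complex.norm_real, Real.norm_of_nonneg (by positivity), div_le_iff₀ (by positivity)]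
      linarith
    have b2 : ‖(4 * (1 - 16 * ((s : ℂ) + 1) ^ 2) / (((s : ℂ) + 2) * ((s : ℂ) + 1)))‖ ≤ 64 := by
      have : (4 * (1 - 16 * ((s : ℂ) + 1) ^ 2) / (((s : ℂ) + 2) * ((s : ℂ) + 1))) =
          -((4 * (16 * ((s : ℝ) + 1) ^ 2 - 1) / (((s : ℝ) + 2) * ((s : ℝ) + 1)) : ℝ) : ℂ) := by
        push_cast; ring
      have h0 : 0 ≤ 16 * ((s : ℝ) + 1) ^ 2 - 1 := by nlinarith
      rw [this, norm_neg, Complex.norm_real, Real.norm_of_nonneg (by positivity), div_le_iff₀ (by positivity)]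
      nlinarith
    have b3 : ‖1 + cc‖ ≤ 2 := by
      refine (norm_add_le _ _).trans ?_
      rw [norm_cc]; norm_num
    have b4 := norm_one_sub_cc
    calc _ ≤ 16 * 2 * (33 : ℝ) ^ (s + 1) + 64 * (1 / 14000) * (33 : ℝ) ^ s := by gcongr
      _ ≤ (33 : ℝ) ^ (s + 2) := by
        have : (0 : ℝ) < 33 ^ s := by positivity
        rw [pow_succ, pow_add]; nlinarith

lemma LL1_A : LL cc 1 1 = 4 / 5 + 4 / 3 * cc := by
  rw [LL_one _ _ one_ne_zero]; ring
lemma LL1_B : LL cc cc 1 = 4 / 3 + 4 / 5 * cc := by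
  rw [LL_one _ _ cc_ne]; have := cc_ne; field_simp; ring

lemma bound_A (r : ℕ) : ‖nu r * LL cc 1 r‖ ≤ 33 ^ r := by
  refine tilde_bound 1 one_ne_zero (qq_eval_one _) ?_ r
  rw [LL1_A]
  refine (norm_add_le _ _).trans ?_
  rw [norm_mul, norm_cc]; norm_num
lemma bound_B (r : ℕ) : ‖nu r * LL cc cc r‖ ≤ 33 ^ r := by
  refine tilde_bound cc cc_ne (qq_eval_c _) ?_ r
  rw [LL1_B]
  refine (norm_add_le _ _).trans ?_
  rw [norm_mul, norm_cc]; norm_num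

lemma det_ne (r : ℕ) : LL cc 1 r * LL cc cc (r + 1) - LL cc 1 (r + 1) * LL cc cc r ≠ 0 := by
  induction r with
  | zero =>
    rw [LL_zero, LL_zero, LL1_A, LL1_B]
    have : (1 * (4 / 3 + 4 / 5 * cc) - (4 / 5 + 4 / 3 * cc) * 1) = 8 / 15 * (1 - cc) := by ring
    rw [this]
    exact mul_ne_zero (by norm_num) one_sub_cc_ne
  | succ s ih =>
    have hA := LL_rec cc 1 one_ne_zero (qq_eval_one _) s
    have hB := LL_rec cc cc cc_ne (qq_eval_c _) s
    intro h
    have n1 : (s : ℂ) + 1 ≠ 0 := by exact_mod_cast Nat.succ_ne_zero s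
    have n2 : (s : ℂ) + 2 ≠ 0 := by exact_mod_cast Nat.succ_ne_zero (s + 1)
    have key : (16 * ((s : ℂ) + 2) * (s + 1) * (1 - cc) ^ 2) *
        (LL cc 1 s * LL cc cc (s + 1) - LL cc 1 (s + 1) * LL cc cc s) = 0 := by
      rw [show s + 1 + 1 = s + 2 from rfl] at h
      linear_combination (16 * ((s : ℂ) + 2) ^ 2 - 1) * h + LL cc cc (s + 1) * hA - LL cc 1 (s + 1) * hB
    refine mul_ne_zero (mul_ne_zero (mul_ne_zero (mul_ne_zero (by norm_num) n2) n1) (pow_ne_zero _ one_sub_cc_ne)) ih key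

lemma norm_nu (r : ℕ) : ‖nu r‖ ≤ 8 ^ r := by
  induction r with
  | zero => simp [nu_zero]
  | succ r ih =>
    rw [nu_succ, norm_mul, pow_succ]
    have : ‖(1 - 16 * ((r : ℂ) + 1) ^ 2) / (2 * ((r : ℂ) + 1) ^ 2)‖ ≤ 8 := by
      have : (1 - 16 * ((r : ℂ) + 1) ^ 2) / (2 * ((r : ℂ) + 1) ^ 2) =
          -(((16 * ((r : ℝ) + 1) ^ 2 - 1) / (2 * ((r : ℝ) + 1) ^ 2) : ℝ) : ℂ) := by
        push_cast; ring
      have h0 : 0 ≤ 16 * ((r : ℝ) + 1) ^ 2 - 1 := by nlinarith [(Nat.cast_nonneg r : (0 : ℝ) ≤ r)]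
      rw [this, norm_neg, Complex.norm_real, Real.norm_of_nonneg (by positivity), div_le_iff₀ (by positivity)]
      nlinarith
    exact mul_le_mul ih this (norm_nonneg _) (pow_nonneg (by norm_num) _)

/-- The Gaussian integers inside the complex numbers. -/
noncomputable def GG : Subring ℂ := GaussianInt.toComplex.range

lemma I_mem : Complex.I ∈ GG := ⟨⟨0, 1⟩, by simp [GaussianInt.toComplex_def]⟩
lemma d_mem : (239 + Complex.I) ∈ GG := by
  exact add_mem (by exact_mod_cast natCast_mem GG 239) I_mem
lemma d_mem' : (239 - Complex.I) ∈ GG := by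
  exact sub_mem (by exact_mod_cast natCast_mem GG 239) I_mem

lemma one_le_of_mem {w : ℂ} (hw : w ∈ GG) (h0 : w ≠ 0) : 1 ≤ ‖w‖ := by
  obtain ⟨g, rfl⟩ := hw
  have hg : g ≠ 0 := by rintro rfl; simp at h0
  have h1 : 1 ≤ g.norm := GaussianInt.norm_pos.mpr hg
  have h2 : (1 : ℝ) ≤ ‖(g : ℂ)‖ ^ 2 := by
    rw [← Complex.normSq_eq_norm_sq, ← GaussianInt.intCast_real_norm]; exact_mod_cast h1
  nlinarith [norm_nonneg (g : ℂ)]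

lemma cc_pow_mem (r m : ℕ) (hm : m ≤ r) : (239 + Complex.I) ^ r * (-cc) ^ m ∈ GG := by
  have : (239 + Complex.I) ^ r * (-cc) ^ m = (-1) ^ m * (239 - Complex.I) ^ m * (239 + Complex.I) ^ (r - m) := by
    have e : r = m + (r - m) := by omega
    have h := d_ne
    rw [neg_pow, cc, div_pow]
    conv_lhs => rw [e, pow_add]
    field_simp
  rw [this]
  exact mul_mem (mul_mem (pow_mem (neg_mem (one_mem _)) _) (pow_mem d_mem' _)) (pow_mem d_mem _)

lemma mem_A (r : ℕ) : (239 + Complex.I) ^ r * (nu r * LL cc 1 r) ∈ GG := by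
  rw [LL_A, Finset.mul_sum, Finset.mul_sum]
  refine sum_mem fun m hm => ?_
  have hm' : m ≤ r := by simp at hm; omega
  obtain ⟨N, hN⟩ := coef_int r m hm'
  have : (239 + Complex.I) ^ r * (nu r * ((-cc) ^ m * ((r.choose m : ℂ) * SS r m))) =
      ((239 + Complex.I) ^ r * (-cc) ^ m) * N := by rw [← hN]; ring
  rw [this]
  exact mul_mem (cc_pow_mem r m hm') (intCast_mem _ _)

lemma mem_B (r : ℕ) : (239 + Complex.I) ^ r * (nu r * LL cc cc r) ∈ GG := by
  rw [LL_B cc cc_ne, Finset.mul_sum, Finset.mul_sum]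
  refine sum_mem fun m hm => ?_
  have hm' : m ≤ r := by simp at hm; omega
  obtain ⟨N, hN⟩ := coef_int r (r - m) (Nat.sub_le _ _)
  have : (239 + Complex.I) ^ r * (nu r * ((-1) ^ r * (-cc) ^ m * ((r.choose (r - m) : ℂ) * SS r (r - m)))) =
      (-1) ^ r * ((239 + Complex.I) ^ r * (-cc) ^ m) * N := by rw [← hN]; ring
  rw [this]
  exact mul_mem (mul_mem (pow_mem (neg_mem (one_mem _)) _) (cc_pow_mem r m hm')) (intCast_mem _ _)

lemma Phi_deriv (r : ℕ) (F : ℂ[X]) (u : ℂ) (hu : u ≠ 0) :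
    HasDerivAt (fun u : ℂ => u * Phi r (u ^ 4) F) ((u ^ 4) ^ (-(r : ℤ)) * F.eval (u ^ 4)) u := by
  induction F using Polynomial.induction_on' with
  | add p q hp hq =>
    simp only [map_add, mul_add, eval_add]
    exact hp.add hq
  | monomial n a =>
    have hd := den_ne n r
    have h := ((hasDerivAt_zpow (4 * ((n : ℤ) - r) + 1) u (Or.inl hu)).mul_const
      (a / (4 * ((n : ℂ) - r) + 1)))
    have h4 : u ^ 4 ≠ 0 := pow_ne_zero _ hu
    have hz : ∀ k : ℤ, (u ^ 4) ^ k = u ^ (4 * k) := fun k => by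
      rw [zpow_mul]; norm_cast
    refine HasDerivAt.congr_of_eventuallyEq (f := fun u => u ^ (4 * ((n : ℤ) - r) + 1) * (a / (4 * ((n : ℂ) - r) + 1))) ?_ ?_
    · refine h.congr_deriv ?_
      rw [eval_monomial]
      push_cast
      have : (u ^ 4) ^ n = (u ^ 4) ^ (n : ℤ) := by simp
      rw [this, hz, hz]
      have : u ^ (4 * ((n : ℤ) - r) + 1 - 1) = u ^ (4 * -(r : ℤ)) * u ^ (4 * (n : ℤ)) := by
        rw [← zpow_add₀ hu]; congr 1; ring
      rw [this]
      field_simp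
    · filter_upwards [isOpen_ne.mem_nhds hu] with v hv
      rw [Phi_monomial, zpow_add₀ hv, zpow_mul]
      simp only [zpow_one]
      norm_cast
      ring

lemma exists_eta : ∃ η : ℂ, η ^ 4 = cc ∧ ‖η‖ = 1 ∧ ‖η - 1‖ ≤ 1 / 478 := by
  set ψ := Real.arctan (1 / 239) with hψ
  have h0 : 0 < ψ := Real.arctan_pos.mpr (by norm_num)
  have h1 : ψ ≤ 1 / 239 := by
    have := Real.lt_tan h0 (Real.arctan_lt_pi_div_two _)
    rw [Real.tan_arctan] at this
    exact this.le
  refine ⟨Complex.exp (Complex.I * ((-ψ / 2 : ℝ) : ℂ)), ?_, Complex.norm_exp_I_mul_ofReal _, ?_⟩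
  · rw [← Complex.exp_nat_mul]
    have hc : Complex.exp (Complex.I * ((ψ : ℝ) : ℂ)) = (239 + Complex.I) * ((Real.cos ψ / 239 : ℝ) : ℂ) := by
      rw [mul_comm, Complex.exp_mul_I, ← Complex.ofReal_cos, ← Complex.ofReal_sin]
      have : Real.sin ψ = Real.cos ψ / 239 := by
        have ht : Real.tan ψ = 1 / 239 := Real.tan_arctan _
        rw [Real.tan_eq_sin_div_cos] at ht
        have := (Real.cos_arctan_pos (1 / 239)).ne'
        rw [← hψ] at this
        field_simp at ht ⊢
        linarith
      rw [this]; push_cast; ring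
    have hcos : (Real.cos ψ / 239) ^ 2 = 1 / 57122 := by
      rw [div_pow, Real.cos_sq_arctan]; norm_num
    have e : ((4 : ℕ) : ℂ) * (Complex.I * ((-ψ / 2 : ℝ) : ℂ)) = -(Complex.I * (ψ : ℂ) + Complex.I * (ψ : ℂ)) := by
      push_cast; ring
    rw [e, Complex.exp_neg, Complex.exp_add, hc]
    have hcos' : ((Real.cos ψ / 239 : ℝ) : ℂ) ^ 2 = 1 / 57122 := by
      rw [← Complex.ofReal_pow, hcos]; norm_num
    have hd : (239 + Complex.I) * (239 - Complex.I) = 57122 := by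
      linear_combination -Complex.I_sq
    rw [cc, eq_div_iff d_ne, inv_mul_eq_iff_eq_mul₀]
    · generalize ((Real.cos ψ / 239 : ℝ) : ℂ) = t at *
      linear_combination -(239 + Complex.I) * (239 + Complex.I) * (239 - Complex.I) * hcos' - (239 + Complex.I) / 57122 * hd
    · rw [← hc]; exact mul_ne_zero (Complex.exp_ne_zero _) (Complex.exp_ne_zero _)
  · refine Real.norm_exp_I_mul_ofReal_sub_one_le.trans ?_
    rw [Real.norm_eq_abs, abs_le]
    constructor <;> linarith

lemma err_bound (η : ℂ) (h4 : η ^ 4 = cc) (h1 : ‖η‖ = 1) (hd : ‖η - 1‖ ≤ 1 / 478) (r : ℕ) :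
    ‖η * LL cc cc r - LL cc 1 r‖ ≤ (4 * (1 / 478) ^ 2 / (477 / 478) ^ 4) ^ r * (1 / 478) := by
  have main := Convex.norm_image_sub_le_of_norm_hasDerivWithin_le
    (f := fun u : ℂ => u * Phi r (u ^ 4) (qq cc ^ r))
    (f' := fun u : ℂ => (u ^ 4) ^ (-(r : ℤ)) * (qq cc ^ r).eval (u ^ 4))
    (s := segment ℝ (1 : ℂ) η) (x := 1) (y := η)
    (C := (4 * (1 / 478) ^ 2 / (477 / 478) ^ 4) ^ r) ?_ ?_ (convex_segment _ _)
    (left_mem_segment _ _ _) (right_mem_segment _ _ _)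
  · simp only [h4, one_pow, one_mul] at main
    refine main.trans ?_
    gcongr
  all_goals
    intro u hu
    rw [segment_eq_image'] at hu
    obtain ⟨t, ⟨ht0, ht1⟩, rfl⟩ := hu
    have hlow : 477 / 478 ≤ ‖1 + t • (η - 1)‖ := by
      have e : (1 : ℂ) = (1 + t • (η - 1)) + -(t • (η - 1)) := by ring
      have := norm_add_le (1 + t • (η - 1)) (-(t • (η - 1)))
      rw [← e, norm_neg, norm_smul, Real.norm_of_nonneg ht0] at this
      have h5 : t * ‖η - 1‖ ≤ 1 * (1 / 478) := by gcongr
      rw [norm_one] at this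
      linarith
    have hne : 1 + t • (η - 1) ≠ 0 := by
      intro h; rw [h] at hlow; norm_num at hlow
  · exact (Phi_deriv r _ _ hne).hasDerivWithinAt
  · beta_reduce
    have hup : ‖1 + t • (η - 1)‖ ≤ 1 := by
      have e : 1 + t • (η - 1) = ((1 - t : ℝ) : ℂ) + (t : ℂ) * η := by
        simp only [Complex.real_smul]; push_cast; ring
      rw [e]
      refine (norm_add_le _ _).trans ?_
      rw [norm_mul, h1, Complex.norm_real, Complex.norm_real, Real.norm_of_nonneg ht0,
        Real.norm_of_nonneg (by linarith)]
      linarith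
    have d1 : ‖1 - (1 + t • (η - 1))‖ = t * ‖η - 1‖ := by
      have e : 1 - (1 + t • (η - 1)) = -(t • (η - 1)) := by ring
      rw [e, norm_neg, norm_smul, Real.norm_of_nonneg ht0]
    have d2 : ‖(1 + t • (η - 1)) - η‖ = (1 - t) * ‖η - 1‖ := by
      have e : (1 + t • (η - 1)) - η = -((1 - t) • (η - 1)) := by
        simp only [Complex.real_smul]; push_cast; ring
      rw [e, norm_neg, norm_smul, Real.norm_of_nonneg (by linarith)]
    generalize 1 + t • (η - 1) = u at *
    have pw : ∀ a b : ℂ, ‖a‖ ≤ 1 → ‖b‖ ≤ 1 → ‖a ^ 4 - b ^ 4‖ ≤ 4 * ‖a - b‖ := by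
      intro a b ha hb
      have e : a ^ 4 - b ^ 4 = (a ^ 3 + a ^ 2 * b + a * b ^ 2 + b ^ 3) * (a - b) := by ring
      rw [e, norm_mul]
      gcongr
      calc ‖a ^ 3 + a ^ 2 * b + a * b ^ 2 + b ^ 3‖ ≤ ‖a ^ 3‖ + ‖a ^ 2 * b‖ + ‖a * b ^ 2‖ + ‖b ^ 3‖ := norm_add₄_le
        _ = ‖a‖ ^ 3 + ‖a‖ ^ 2 * ‖b‖ + ‖a‖ * ‖b‖ ^ 2 + ‖b‖ ^ 3 := by simp [norm_pow]
        _ ≤ 1 ^ 3 + 1 ^ 2 * 1 + 1 * 1 ^ 2 + 1 ^ 3 := by gcongr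
        _ = 4 := by norm_num
    have q1 := pw 1 u (by simp) hup
    have q2 := pw u η hup h1.le
    rw [one_pow, d1] at q1
    rw [h4, d2] at q2
    have e : (u ^ 4) ^ (-(r : ℤ)) * (qq cc ^ r).eval (u ^ 4) = ((u ^ 4 - cc) * (1 - u ^ 4) / u ^ 4) ^ r := by
      rw [eval_pow, zpow_neg, zpow_natCast, div_pow]
      simp [qq]
      ring
    rw [e, norm_pow, norm_div, norm_mul, norm_pow]
    have h0 : 0 ≤ ‖η - 1‖ := norm_nonneg _
    have hprod : ‖u ^ 4 - cc‖ * ‖1 - u ^ 4‖ ≤ 4 * (1 / 478) ^ 2 := by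
      calc _ ≤ (4 * ((1 - t) * ‖η - 1‖)) * (4 * (t * ‖η - 1‖)) := by gcongr
        _ = 16 * (t * (1 - t)) * ‖η - 1‖ ^ 2 := by ring
        _ ≤ 16 * (1 / 4) * (1 / 478) ^ 2 := by
          gcongr
          nlinarith [sq_nonneg (t - 1 / 2)]
        _ = _ := by norm_num
    gcongr

lemma near_unit (y e : ℂ) (h : y ^ 4 = e) : ∃ κ ∈ GG, ‖κ‖ = 1 ∧ ‖y - κ‖ ≤ ‖e - 1‖ := by
  have two : ∀ a b : ℂ, ‖b‖ = 1 → ∃ s : ℂ, (s = 1 ∨ s = -1) ∧ ‖a - s * b‖ ≤ ‖a ^ 2 - b ^ 2‖ := by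
    intro a b hb
    have hf : ‖a ^ 2 - b ^ 2‖ = ‖a - b‖ * ‖a + b‖ := by rw [← norm_mul]; congr 1; ring
    have hs : 2 ≤ ‖a - b‖ + ‖a + b‖ := by
      have h2 : ‖(a + b) - (a - b)‖ = 2 := by
        have : (a + b) - (a - b) = 2 * b := by ring
        rw [this, norm_mul, hb]; norm_num
      have := norm_sub_le (a + b) (a - b)
      linarith
    rcases le_total 1 ‖a + b‖ with h1 | h1
    · refine ⟨1, Or.inl rfl, ?_⟩
      rw [hf, one_mul]
      nlinarith [norm_nonneg (a - b)]
    · refine ⟨-1, Or.inr rfl, ?_⟩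
      have : a - -1 * b = a + b := by ring
      rw [hf, this]
      nlinarith [norm_nonneg (a + b)]
  obtain ⟨s, hs, h1⟩ := two (y ^ 2) 1 (by simp)
  have hle : ‖y ^ 2 - s‖ ≤ ‖e - 1‖ := by
    rw [← h]; convert h1 using 2 <;> ring
  have fin : ∀ b : ℂ, b ∈ GG → ‖b‖ = 1 → b ^ 2 = s → ∃ κ ∈ GG, ‖κ‖ = 1 ∧ ‖y - κ‖ ≤ ‖e - 1‖ := by
    intro b hb hb1 hb2
    obtain ⟨s', hs', h2⟩ := two y b hb1
    refine ⟨s' * b, ?_, ?_, ?_⟩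
    · rcases hs' with rfl | rfl
      · exact mul_mem (one_mem _) hb
      · exact mul_mem (neg_mem (one_mem _)) hb
    · rcases hs' with rfl | rfl <;> simp [hb1]
    · rw [hb2] at h2; exact h2.trans hle
  rcases hs with rfl | rfl
  · exact fin 1 (one_mem _) (by simp) (by simp)
  · exact fin Complex.I I_mem (by simp) (by simp)

open ComplexConjugate in
theorem core (x : ℤ) (z : GaussianInt)
    (h : ((x : ℂ) + Complex.I) * (conj (z : ℂ)) ^ 4 = -Complex.I * ((x : ℂ) - Complex.I) * (z : ℂ) ^ 4)
    (hn : ‖(z : ℂ)‖ ^ 4 ≤ |(x : ℝ)|) (hz : 29 ^ 19 < ‖(z : ℂ)‖) : False := by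
  obtain ⟨η, hη4, hη1, hηd⟩ := exists_eta
  set Z := ‖(z : ℂ)‖ with hZ
  have hZ0 : 0 < Z := lt_trans (by positivity) hz
  have hz0 : (z : ℂ) ≠ 0 := by rw [← norm_pos_iff]; exact hZ0
  have hzc0 : conj (z : ℂ) ≠ 0 := by simpa using hz0
  have hη0 : η ≠ 0 := by intro h; rw [h] at hη1; simp at hη1
  have hxI : ((x : ℂ) - Complex.I) ≠ 0 := by
    intro h; have := congrArg Complex.im h; simp at this
  have hxI' : ((x : ℂ) + Complex.I) ≠ 0 := by
    intro h; have := congrArg Complex.im h; simp at this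
  have hb : (3 + 2 * Complex.I : ℂ) ≠ 0 := by
    intro h; have := congrArg Complex.im h; simp at this
  have hb' : (3 - 2 * Complex.I : ℂ) ≠ 0 := by
    intro h; have := congrArg Complex.im h; simp at this
  have hI4 : Complex.I ^ 4 = 1 := Complex.I_pow_four
  have h23 : (239 + Complex.I) * (3 + 2 * Complex.I) ^ 4 = -Complex.I * (239 - Complex.I) * (3 - 2 * Complex.I) ^ 4 := by
    have := Complex.I_sq
    grind
  set ρ : ℂ := (z : ℂ) * (3 + 2 * Complex.I) / (conj (z : ℂ) * (3 - 2 * Complex.I)) with hρ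
  have hρ4 : (ρ / η) ^ 4 = ((x : ℂ) + Complex.I) / ((x : ℂ) - Complex.I) := by
    have hd := d_ne
    rw [div_pow, hη4, cc, hρ, div_pow, mul_pow, mul_pow]
    have hd' := d_ne'
    have hzc4 : conj (z : ℂ) ^ 4 = -Complex.I * ((x : ℂ) - Complex.I) * (z : ℂ) ^ 4 / ((x : ℂ) + Complex.I) := by
      field_simp; linear_combination h
    have hb4 : (3 + 2 * Complex.I) ^ 4 = -Complex.I * (239 - Complex.I) * (3 - 2 * Complex.I) ^ 4 / (239 + Complex.I) := by
      field_simp; linear_combination h23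
    rw [hzc4, hb4]
    have := Complex.I_ne_zero
    field_simp
    exact div_self (by rwa [mul_comm])
  obtain ⟨κ, hκG, hκ1, hκ⟩ := near_unit _ _ hρ4
  have hx0 : 0 < |(x : ℝ)| := lt_of_lt_of_le (by positivity) hn
  have he : ‖((x : ℂ) + Complex.I) / ((x : ℂ) - Complex.I) - 1‖ ≤ 2 / Z ^ 4 := by
    have e : ((x : ℂ) + Complex.I) / ((x : ℂ) - Complex.I) - 1 = 2 * Complex.I / ((x : ℂ) - Complex.I) := by
      field_simp; ring
    have hx : |(x : ℝ)| ≤ ‖(x : ℂ) - Complex.I‖ := by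
      have := Complex.abs_re_le_norm ((x : ℂ) - Complex.I)
      simpa using this
    rw [e, norm_div]
    have : ‖2 * Complex.I‖ = 2 := by simp
    rw [this]
    gcongr
    exact hn.trans hx
  have hyκ := hκ.trans he
  -- the linear forms
  let a : ℕ → ℂ := fun r => (239 + Complex.I) ^ r * (nu r * LL cc 1 r)
  let b : ℕ → ℂ := fun r => (239 + Complex.I) ^ r * (nu r * LL cc cc r)
  let Λ : ℕ → ℂ := fun r => (z : ℂ) * (3 + 2 * Complex.I) * b r - κ * (conj (z : ℂ) * (3 - 2 * Complex.I)) * a r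
  have hzG : (z : ℂ) ∈ GG := ⟨z, rfl⟩
  have hzcG : conj (z : ℂ) ∈ GG := ⟨star z, by simp⟩
  have h2G : (2 : ℂ) ∈ GG := by exact_mod_cast natCast_mem GG 2
  have h3G : (3 : ℂ) ∈ GG := by exact_mod_cast natCast_mem GG 3
  have hΛG : ∀ r, Λ r ∈ GG := fun r =>
    sub_mem (mul_mem (mul_mem hzG (add_mem h3G (mul_mem h2G I_mem))) (mem_B r))
      (mul_mem (mul_mem hκG (mul_mem hzcG (sub_mem h3G (mul_mem h2G I_mem)))) (mem_A r))
  have hbr : ∀ r, ‖b r‖ ≤ 8000 ^ r := by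
    intro r
    have := bound_B r
    calc ‖b r‖ = ‖(239 + Complex.I : ℂ)‖ ^ r * ‖nu r * LL cc cc r‖ := by simp only [b, norm_mul, norm_pow]
      _ ≤ 239.01 ^ r * 33 ^ r := by gcongr; exact norm_d_le
      _ = (239.01 * 33) ^ r := by rw [mul_pow]
      _ ≤ 8000 ^ r := by gcongr; norm_num
  have her : ∀ r, ‖η * b r - a r‖ ≤ (1 / 29) ^ r * (1 / 478) := by
    intro r
    have h1 := err_bound η hη4 hη1 hηd r
    have h2 := norm_nu r
    have e : η * b r - a r = (239 + Complex.I) ^ r * nu r * (η * LL cc cc r - LL cc 1 r) := by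
      simp only [a, b]; ring
    rw [e, norm_mul, norm_mul, norm_pow]
    calc _ ≤ (239.01 : ℝ) ^ r * 8 ^ r * ((4 * (1 / 478) ^ 2 / (477 / 478) ^ 4) ^ r * (1 / 478)) := by
          gcongr; exact norm_d_le
      _ = (239.01 * 8 * (4 * (1 / 478) ^ 2 / (477 / 478) ^ 4)) ^ r * (1 / 478) := by
          rw [mul_pow, mul_pow]; ring
      _ ≤ _ := by gcongr; norm_num
  have hn13 : ‖(3 - 2 * Complex.I : ℂ)‖ ≤ 4 := by
    have : ‖(3 - 2 * Complex.I : ℂ)‖ ^ 2 = 13 := by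
      rw [← Complex.normSq_eq_norm_sq]; norm_num [Complex.normSq_apply]
    nlinarith [norm_nonneg (3 - 2 * Complex.I : ℂ)]
  have hΛle : ∀ r, ‖Λ r‖ ≤ (Z * 4) * (2 / Z ^ 4 * 8000 ^ r + (1 / 29) ^ r * (1 / 478)) := by
    intro r
    have e : Λ r = (conj (z : ℂ) * (3 - 2 * Complex.I)) * ((ρ / η - κ) * (η * b r) + κ * (η * b r - a r)) := by
      have : (z : ℂ) * (3 + 2 * Complex.I) = (conj (z : ℂ) * (3 - 2 * Complex.I)) * ρ := by
        rw [hρ]; field_simp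
      simp only [Λ]
      rw [this]
      field_simp
      ring
    rw [e, norm_mul, norm_mul, Complex.norm_conj]
    have : ‖(ρ / η - κ) * (η * b r) + κ * (η * b r - a r)‖ ≤ 2 / Z ^ 4 * 8000 ^ r + (1 / 29) ^ r * (1 / 478) := by
      refine (norm_add_le _ _).trans ?_
      rw [norm_mul (ρ / η - κ), norm_mul η, norm_mul κ, hη1, hκ1, one_mul, one_mul]
      have := hbr r; have := her r
      gcongr
    gcongr
  obtain ⟨n, hn1, hn2⟩ := exists_nat_pow_near (x := Z) (y := 29) (by linarith [show (1 : ℝ) ≤ 29 ^ 19 by norm_num]) (by norm_num)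
  have hn19 : 19 ≤ n := by
    have : (29 : ℝ) ^ 19 < 29 ^ (n + 1) := hz.trans hn2
    have := (pow_lt_pow_iff_right₀ (by norm_num : (1 : ℝ) < 29)).mp this
    omega
  have hsmall : ∀ r, n + 1 ≤ r → r ≤ n + 2 → ‖Λ r‖ < 1 := by
    intro r hr1 hr2
    refine (hΛle r).trans_lt ?_
    have t1 : (Z * 4) * (2 / Z ^ 4 * 8000 ^ r) ≤ 8 * 8000 ^ 2 * (8000 / 24389) ^ 19 := by
      calc (Z * 4) * (2 / Z ^ 4 * 8000 ^ r) = 8 * 8000 ^ r / Z ^ 3 := by field_simp; ring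
        _ ≤ 8 * 8000 ^ (n + 2) / (29 ^ n) ^ 3 := by gcongr; norm_num
        _ = 8 * 8000 ^ 2 * (8000 / 24389) ^ n := by
          rw [← pow_mul, mul_comm n 3, pow_mul, div_pow]; norm_num; ring
        _ ≤ _ := by
          have := pow_le_pow_of_le_one (a := (8000 / 24389 : ℝ)) (by norm_num) (by norm_num) hn19
          gcongr
    have t2 : (Z * 4) * ((1 / 29) ^ r * (1 / 478)) ≤ 4 / 478 := by
      have : (1 / 29 : ℝ) ^ r ≤ (1 / 29) ^ (n + 1) := pow_le_pow_of_le_one (by norm_num) (by norm_num) hr1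
      calc (Z * 4) * ((1 / 29) ^ r * (1 / 478)) ≤ (29 ^ (n + 1) * 4) * ((1 / 29) ^ (n + 1) * (1 / 478)) := by gcongr
        _ = (29 * (1 / 29)) ^ (n + 1) * (4 / 478) := by rw [mul_pow]; ring
        _ = _ := by norm_num
    rw [mul_add]
    refine (add_le_add t1 t2).trans_lt ?_
    norm_num
  have hzero : ∀ r, n + 1 ≤ r → r ≤ n + 2 → Λ r = 0 := by
    intro r h1 h2
    by_contra h3
    exact absurd (one_le_of_mem (hΛG r) h3) (not_le.mpr (hsmall r h1 h2))
  have red : ∀ r, Λ r = 0 → (z : ℂ) * (3 + 2 * Complex.I) * LL cc cc r = κ * (conj (z : ℂ) * (3 - 2 * Complex.I)) * LL cc 1 r := by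
    intro r hr
    have e : Λ r = ((239 + Complex.I) ^ r * nu r) * ((z : ℂ) * (3 + 2 * Complex.I) * LL cc cc r - κ * (conj (z : ℂ) * (3 - 2 * Complex.I)) * LL cc 1 r) := by
      simp only [Λ, a, b]; ring
    rw [e] at hr
    rcases mul_eq_zero.mp hr with h | h
    · exact absurd h (mul_ne_zero (pow_ne_zero _ d_ne) (nu_ne r))
    · exact sub_eq_zero.mp h
  have r1 := red _ (hzero (n + 1) le_rfl (by omega))
  have r2 := red _ (hzero (n + 2) (by omega) le_rfl)
  have hdet := det_ne (n + 1)
  apply mul_ne_zero (mul_ne_zero hz0 hb) hdet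
  linear_combination LL cc 1 (n + 1) * r2 - LL cc 1 (n + 2) * r1

def pstep (p : ℕ × ℕ) : ℕ × ℕ := (3 * p.1 + 4 * p.2, 2 * p.1 + 3 * p.2)

def pl : ℕ → ℕ × ℕ
  | 0 => (1, 1)
  | n + 1 => pstep (pl n)

set_option maxRecDepth 100000 in
lemma pl_check : ∀ n < 160, Nat.sqrt (pl n).2 * Nat.sqrt (pl n).2 = (pl n).2 → n = 0 ∨ n = 3 := by
  decide +kernel

lemma pl_spec : ∀ Y X : ℕ, X ^ 2 + 1 = 2 * Y ^ 2 → ∃ n, pl n = (X, Y) := by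
  intro Y
  induction Y using Nat.strong_induction_on with
  | _ Y ih =>
    intro X h
    rcases Nat.lt_or_ge Y 3 with hY | hY
    · interval_cases Y
      · omega
      · have : X = 1 := by nlinarith
        exact ⟨0, by rw [this]; rfl⟩
      · have : X < 3 := by nlinarith
        interval_cases X <;> omega
    · have h1 : Y < X := by nlinarith
      have h2 : 4 * Y ≤ 3 * X := by nlinarith
      have h3 : 2 * X ≤ 3 * Y := by nlinarith
      obtain ⟨a, ha⟩ := Nat.exists_eq_add_of_le h2
      obtain ⟨b, hb⟩ := Nat.exists_eq_add_of_le h3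
      have hab : a ^ 2 + 1 = 2 * b ^ 2 := by
        zify at *
        have ea : (a : ℤ) = 3 * X - 4 * Y := by linarith
        have eb : (b : ℤ) = 3 * Y - 2 * X := by linarith
        rw [ea, eb]; linear_combination h
      obtain ⟨n, hn⟩ := ih b (by omega) a hab
      refine ⟨n + 1, ?_⟩
      rw [pl, hn, pstep]
      ext <;> simp <;> omega

lemma pl_growth : ∀ n, 5 ^ n ≤ (pl n).2 ∧ (pl n).2 ≤ (pl n).1 := by
  intro n
  induction n with
  | zero => simp [pl]
  | succ n ih =>
    rw [pl, pstep, pow_succ]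
    obtain ⟨h1, h2⟩ := ih
    constructor <;> dsimp only <;> omega

lemma small_case (x w : ℕ) (h : x ^ 2 + (x + 1) ^ 2 = w ^ 4) (hw : w ≤ 29 ^ 38) :
    (x = 0 ∧ w = 1) ∨ (x = 119 ∧ w = 13) := by
  obtain ⟨n, hn⟩ := pl_spec (w ^ 2) (2 * x + 1) (by nlinarith)
  have hg := (pl_growth n).1
  have hn2 : (pl n).2 = w ^ 2 := by rw [hn]
  have hn1 : (pl n).1 = 2 * x + 1 := by rw [hn]
  have hlt : n < 160 := by
    by_contra hge
    have h1 : 5 ^ 160 ≤ 5 ^ n := Nat.pow_le_pow_right (by norm_num) (by omega)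
    have h2 : w ^ 2 ≤ (29 ^ 38) ^ 2 := Nat.pow_le_pow_left hw 2
    rw [hn2] at hg
    have h3 : (29 ^ 38) ^ 2 < 5 ^ 160 := by norm_num
    omega
  rcases pl_check n hlt (by rw [hn2, pow_two, Nat.sqrt_eq]) with rfl | rfl
  · simp [pl] at hn1 hn2
    left; constructor
    · omega
    · nlinarith
  · simp [pl, pstep] at hn1 hn2
    right; constructor
    · omega
    · nlinarith

open ComplexConjugate in
lemma big_case (x w : ℕ) (h : x ^ 2 + (x + 1) ^ 2 = w ^ 4) (hw : 29 ^ 38 < w) : False := by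
  set g : GaussianInt := ⟨x, x + 1⟩ with hg
  have hprod : g * star g = (w : GaussianInt) ^ 4 := by
    have e : ((w : GaussianInt) ^ 4) = ((w ^ 4 : ℕ) : GaussianInt) := by push_cast; rfl
    rw [e, hg]
    have h' : (x : ℤ) ^ 2 + (x + 1) ^ 2 = ((w ^ 4 : ℕ) : ℤ) := by exact_mod_cast h
    clear e
    generalize w ^ 4 = N at h' ⊢
    ext
    · simp
      linarith
    · simp
      ring
  have hcop : IsCoprime g (star g) := by
    refine ⟨star g + ⟨x ^ 2 + x, x ^ 2 + x⟩, ⟨x ^ 2 + x, -(x ^ 2 + x)⟩, ?_⟩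
    rw [hg]
    ext <;> simp <;> ring
  obtain ⟨z, u, hu⟩ := exists_associated_pow_of_mul_eq_pow' hcop hprod
  have hun : (u : GaussianInt).norm = 1 := (Zsqrtd.norm_eq_one_iff' (by norm_num) _).mpr u.isUnit
  have hgC : (x : ℂ) + (x + 1) * Complex.I = (z : ℂ) ^ 4 * ((u : GaussianInt) : ℂ) := by
    have := congrArg GaussianInt.toComplex hu
    rw [map_mul, map_pow] at this
    rw [this, hg, GaussianInt.toComplex_def']
    push_cast; rfl
  have hgC' : (x : ℂ) - (x + 1) * Complex.I = conj (z : ℂ) ^ 4 * conj ((u : GaussianInt) : ℂ) := by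
    have := congrArg conj hgC
    simp only [map_mul, map_pow, map_add, map_one, Complex.conj_I, Complex.conj_natCast] at this
    linear_combination this
  have hu1 : ‖((u : GaussianInt) : ℂ)‖ ^ 2 = 1 := by
    rw [← Complex.normSq_eq_norm_sq, ← GaussianInt.intCast_real_norm, hun]; simp
  have hZ8 : ‖(z : ℂ)‖ ^ 8 = (w : ℝ) ^ 4 := by
    have e1 : ‖(x : ℂ) + (x + 1) * Complex.I‖ ^ 2 = (w : ℝ) ^ 4 := by
      rw [← Complex.normSq_eq_norm_sq, Complex.normSq_apply]
      simp
      exact_mod_cast (by rw [← h]; ring : x * x + (x + 1) * (x + 1) = w ^ 4)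
    rw [hgC, norm_mul, mul_pow, hu1, norm_pow] at e1
    rw [← e1]; ring
  have hZbig : 29 ^ 19 < ‖(z : ℂ)‖ := by
    have h1 : ((29 : ℝ) ^ 38) ^ 4 < (w : ℝ) ^ 4 := by
      have : (29 : ℝ) ^ 38 < w := by exact_mod_cast hw
      gcongr
    rw [← hZ8] at h1
    refine lt_of_pow_lt_pow_left₀ 8 (norm_nonneg _) (lt_of_eq_of_lt ?_ h1)
    norm_num
  have hZx : ‖(z : ℂ)‖ ^ 4 ≤ 2 * (x : ℝ) + 1 := by
    refine le_of_sq_le_sq ?_ (by positivity)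
    rw [← pow_mul, hZ8]
    have : (w : ℝ) ^ 4 = x ^ 2 + (x + 1) ^ 2 := by exact_mod_cast h.symm
    rw [this]; nlinarith [(Nat.cast_nonneg x : (0 : ℝ) ≤ x)]
  have hX1 : 2 * (x : ℂ) + 1 + Complex.I = (1 - Complex.I) * ((z : ℂ) ^ 4 * ((u : GaussianInt) : ℂ)) := by
    rw [← hgC]; linear_combination (x + 1) * Complex.I_sq
  have hX2 : 2 * (x : ℂ) + 1 - Complex.I = (1 + Complex.I) * (conj (z : ℂ) ^ 4 * conj ((u : GaussianInt) : ℂ)) := by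
    rw [← hgC']; linear_combination (x + 1) * Complex.I_sq
  have hcases : conj ((u : GaussianInt) : ℂ) = ((u : GaussianInt) : ℂ) ∨ conj ((u : GaussianInt) : ℂ) = -((u : GaussianInt) : ℂ) := by
    rw [Zsqrtd.norm_def] at hun
    have : (u : GaussianInt).re = 0 ∨ (u : GaussianInt).im = 0 := by
      by_contra hcon
      push Not at hcon
      obtain ⟨h1, h2⟩ := hcon
      have := mul_self_pos.mpr h1
      have := mul_self_pos.mpr h2
      linarith
    rcases this with h0 | h0
    · right; rw [GaussianInt.toComplex_def, h0]; simp
    · left; rw [GaussianInt.toComplex_def, h0]; simp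
  have hIsq := Complex.I_sq
  rcases hcases with hc | hc
  · refine core (2 * x + 1) z ?_ ?_ hZbig
    · push_cast
      rw [hX1, hX2, hc]
      linear_combination (conj (z : ℂ) ^ 4 * (z : ℂ) ^ 4 * ((u : GaussianInt) : ℂ)) * hIsq
    · push_cast
      exact hZx.trans (le_abs_self _)
  · refine core (-(2 * x + 1)) (star z) ?_ ?_ ?_
    · push_cast
      rw [GaussianInt.toComplex_star, Complex.conj_conj]
      have e1 : -(2 * (x : ℂ) + 1) + Complex.I = -(2 * (x : ℂ) + 1 - Complex.I) := by ring
      have e2 : -(2 * (x : ℂ) + 1) - Complex.I = -(2 * (x : ℂ) + 1 + Complex.I) := by ring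
      rw [e1, e2, hX1, hX2, hc]
      linear_combination (conj (z : ℂ) ^ 4 * (z : ℂ) ^ 4 * ((u : GaussianInt) : ℂ)) * hIsq
    · push_cast
      rw [GaussianInt.toComplex_star, Complex.norm_conj, abs_neg]
      exact hZx.trans (le_abs_self _)
    · rw [GaussianInt.toComplex_star, Complex.norm_conj]; exact hZbig

/-- The Diophantine equation `x² + (x+1)² = w⁴` has exactly two solutions in
non-negative integers, namely `(x, w) = (0, 1)` and `(x, w) = (119, 13)`. -/
theorem stmt_0 (x w : ℕ) :
    x ^ 2 + (x + 1) ^ 2 = w ^ 4 ↔ (x = 0 ∧ w = 1) ∨ (x = 119 ∧ w = 13) := by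
  constructor
  · intro h
    rcases Nat.lt_or_ge (29 ^ 38) w with hw | hw
    · exact (big_case x w h hw).elim
    · exact small_case x w h hw
  · rintro (⟨rfl, rfl⟩ | ⟨rfl, rfl⟩) <;> norm_num
end

section
/- The Diophantine equation x² − 2y⁴ = −1 has exactly two solutions in positive integers, namely (x, y) = (1, 1) and (x, y) = (239, 13). -/
namespace Ljunggren

/-- Denominators of the continued fraction of `tan (arctan x / 4)`. -/
noncomputable def R (x : ℝ) : ℕ → ℝ
  | 0 => 1
  | 1 => 1
  | (n + 2) => (2 * n + 3) * R x (n + 1) + x ^ 2 * ((n + 1) ^ 2 - 1 / 16) * R x n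

/-- Numerators of the continued fraction of `tan (arctan x / 4)`. -/
noncomputable def S (x : ℝ) : ℕ → ℝ
  | 0 => 0
  | 1 => x / 4
  | (n + 2) => (2 * n + 3) * S x (n + 1) + x ^ 2 * ((n + 1) ^ 2 - 1 / 16) * S x n

lemma R_succ (x : ℝ) (n : ℕ) :
    R x (n + 2) = (2 * n + 3) * R x (n + 1) + x ^ 2 * ((n + 1) ^ 2 - 1 / 16) * R x n := rfl

lemma S_succ (x : ℝ) (n : ℕ) :
    S x (n + 2) = (2 * n + 3) * S x (n + 1) + x ^ 2 * ((n + 1) ^ 2 - 1 / 16) * S x n := rfl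

lemma kappa_pos (n : ℕ) : (0 : ℝ) < (n + 1) ^ 2 - 1 / 16 := by
  have : (0 : ℝ) ≤ n := n.cast_nonneg
  nlinarith

/-- The product of the `k ^ 2 - 1 / 16`. -/
noncomputable def K : ℕ → ℝ
  | 0 => 1
  | (n + 1) => K n * ((n + 1) ^ 2 - 1 / 16)

lemma K_pos (n : ℕ) : 0 < K n := by
  induction n with
  | zero => simp [K]
  | succ n ih => exact mul_pos ih (kappa_pos n)

lemma K_le (n : ℕ) : K n ≤ (n.factorial : ℝ) ^ 2 := by
  induction n with
  | zero => simp [K]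
  | succ n ih =>
    rw [K, Nat.factorial_succ]
    push_cast
    rw [mul_pow, mul_comm]
    apply mul_le_mul _ ih (K_pos n).le (by positivity)
    linarith

lemma det_eq (x : ℝ) (n : ℕ) :
    S x (n + 1) * R x n - S x n * R x (n + 1) = x / 4 * (-x ^ 2) ^ n * K n := by
  induction n with
  | zero => simp [R, S, K]
  | succ n ih =>
    rw [R_succ, S_succ, K]
    linear_combination (-x ^ 2 * ((n + 1) ^ 2 - 1 / 16)) * ih

lemma R_low (x : ℝ) (n : ℕ) : 0 < R x n ∧ (2 * n + 1) * R x n ≤ R x (n + 1) := by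
  induction n with
  | zero => simp [R]
  | succ n ih =>
    obtain ⟨h1, h2⟩ := ih
    have h3 : 0 < R x (n + 1) := lt_of_lt_of_le (by positivity) h2
    refine ⟨h3, ?_⟩
    rw [R_succ]
    have := mul_nonneg (mul_nonneg (sq_nonneg x) (kappa_pos n).le) h1.le
    push_cast
    nlinarith

lemma R_pos (x : ℝ) (n : ℕ) : 0 < R x n := (R_low x n).1

lemma R_ge (x : ℝ) (n : ℕ) : (2 / 5) * (7 / 4) ^ n * (n.factorial : ℝ) ≤ R x n := by
  have step (n : ℕ) (hn : 3 ≤ n) (h : (2 / 5) * (7 / 4) ^ n * (n.factorial : ℝ) ≤ R x n) :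
      (2 / 5) * (7 / 4) ^ (n + 1) * ((n + 1).factorial : ℝ) ≤ R x (n + 1) := by
    refine le_trans ?_ (R_low x n).2
    have h3 : (3 : ℝ) ≤ n := by exact_mod_cast hn
    rw [Nat.factorial_succ]
    push_cast
    calc (2 / 5) * (7 / 4 : ℝ) ^ (n + 1) * ((n + 1) * (n.factorial : ℝ))
        = (7 / 4 * (n + 1)) * ((2 / 5) * (7 / 4) ^ n * (n.factorial : ℝ)) := by ring
      _ ≤ (2 * n + 1) * R x n := by
        apply mul_le_mul _ h (by positivity) (by positivity)
        linarith
  have h0 : R x 0 = 1 := rfl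
  have h1 : R x 1 = 1 := rfl
  have h2 := (R_low x 1).2
  have h3 := (R_low x 2).2
  norm_num at h2 h3
  have h4 : 15 ≤ R x 3 := by linarith
  match n with
  | 0 => rw [h0]; norm_num
  | 1 => rw [h1]; norm_num
  | 2 => norm_num [Nat.factorial]; linarith
  | n + 3 =>
    induction n with
    | zero => norm_num [Nat.factorial]; linarith
    | succ n ih => exact step (n + 3) (by omega) ih

lemma deriv_RS (x : ℝ) (n : ℕ) :
    (HasDerivAt (fun t => R t (n + 1)) (((n + 1) * x * R x (n + 1) - S x (n + 1) / 4
      - ((n + 1) ^ 2 - 1 / 16) * x * R x n) / (1 + x ^ 2)) x ∧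
    HasDerivAt (fun t => S t (n + 1)) (((n + 1) * x * S x (n + 1) + R x (n + 1) / 4
      - ((n + 1) ^ 2 - 1 / 16) * x * S x n) / (1 + x ^ 2)) x) := by
  have hx : (1 + x ^ 2 : ℝ) ≠ 0 := by positivity
  induction n using Nat.twoStepInduction with
  | zero =>
    have e0 : R x 0 = 1 := rfl
    have e1 : R x 1 = 1 := rfl
    have e2 : S x 0 = 0 := rfl
    have e3 : S x 1 = x / 4 := rfl
    constructor
    · have : HasDerivAt (fun t : ℝ => R t 1) 0 x := hasDerivAt_const x (1 : ℝ)
      refine this.congr_deriv ?_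
      simp only [zero_add, Nat.cast_zero]
      rw [e0, e1, e3]
      field_simp
      ring
    · have : HasDerivAt (fun t : ℝ => S t 1) (1 / 4) x := (hasDerivAt_id x).div_const 4
      refine this.congr_deriv ?_
      simp only [zero_add, Nat.cast_zero]
      rw [e1, e2, e3]
      field_simp
      ring
  | one =>
    have e1 : R x 1 = 1 := rfl
    have e3 : S x 1 = x / 4 := rfl
    have f2 : (fun t => R t 2) = (fun t : ℝ => 3 + t ^ 2 * (15 / 16)) := by
      ext t
      rw [R_succ]; simp only [zero_add, Nat.cast_zero, R]; ring
    have f3 : (fun t => S t 2) = (fun t : ℝ => 3 * (t / 4)) := by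
      ext t
      rw [S_succ]; simp only [zero_add, Nat.cast_zero, S]; ring
    have g2 := congrFun f2 x
    have g3 := congrFun f3 x
    constructor
    · have : HasDerivAt (fun t : ℝ => 3 + t ^ 2 * (15 / 16)) (2 * x * (15 / 16)) x := by
        simpa using ((hasDerivAt_pow 2 x).mul_const (15 / 16 : ℝ)).const_add 3
      rw [← f2] at this
      refine this.congr_deriv ?_
      norm_num only [Nat.cast_one]
      rw [g2, g3, e1]
      field_simp
      ring
    · have : HasDerivAt (fun t : ℝ => 3 * (t / 4)) (3 * (1 / 4)) x :=
        ((hasDerivAt_id x).div_const 4).const_mul 3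
      rw [← f3] at this
      refine this.congr_deriv ?_
      norm_num only [Nat.cast_one]
      rw [g2, g3, e3]
      field_simp
      ring
  | more n ih0 ih1 =>
    obtain ⟨a0, b0⟩ := ih0
    obtain ⟨a1, b1⟩ := ih1
    have hp : HasDerivAt (fun t : ℝ => t ^ 2 * (((n + 1 : ℕ) + 1 : ℝ) ^ 2 - 1 / 16))
        (2 * x * (((n + 1 : ℕ) + 1 : ℝ) ^ 2 - 1 / 16)) x := by
      simpa using (hasDerivAt_pow 2 x).mul_const (((n + 1 : ℕ) + 1 : ℝ) ^ 2 - 1 / 16)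
    constructor
    · have := (a1.const_mul (2 * (n + 1 : ℕ) + 3 : ℝ)).add (hp.mul a0)
      refine HasDerivAt.congr_deriv (f := fun t => R t (n + 3)) this ?_
      have e1 := R_succ x n
      have e2 := R_succ x (n + 1)
      have e3 := S_succ x (n + 1)
      push_cast at *
      rw [show n + 2 + 1 = n + 1 + 2 from rfl, e2, e3, show n + 1 + 1 = n + 2 from rfl, e1]
      field_simp
      ring
    · have := (b1.const_mul (2 * (n + 1 : ℕ) + 3 : ℝ)).add (hp.mul b0)
      refine HasDerivAt.congr_deriv (f := fun t => S t (n + 3)) this ?_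
      have e1 := S_succ x n
      have e2 := S_succ x (n + 1)
      have e3 := R_succ x (n + 1)
      push_cast at *
      rw [show n + 2 + 1 = n + 1 + 2 from rfl, e2, e3, show n + 1 + 1 = n + 2 from rfl, e1]
      field_simp
      ring

lemma deriv_arctan (t : ℝ) (n : ℕ) :
    HasDerivAt (fun t => Real.arctan (S t (n + 1) / R t (n + 1)) - Real.arctan t / 4)
      (((n + 1) ^ 2 - 1 / 16) * t * (t / 4 * (-t ^ 2) ^ n * K n) /
        ((1 + t ^ 2) * (R t (n + 1) ^ 2 + S t (n + 1) ^ 2))) t := by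
  obtain ⟨a, b⟩ := deriv_RS t n
  have hR := R_pos t (n + 1)
  have := ((b.div a hR.ne').arctan).sub ((Real.hasDerivAt_arctan t).div_const 4)
  refine HasDerivAt.congr_deriv this ?_
  have hx : (1 + t ^ 2 : ℝ) ≠ 0 := by positivity
  have h2 : R t (n + 1) ^ 2 + S t (n + 1) ^ 2 ≠ 0 := by positivity
  have h3 : 1 + (S t (n + 1) / R t (n + 1)) ^ 2 ≠ 0 := by positivity
  rw [← det_eq]
  simp only [Pi.div_apply]
  have h4 : 1 + (S t (n + 1) / R t (n + 1)) ^ 2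
    = (R t (n + 1) ^ 2 + S t (n + 1) ^ 2) / R t (n + 1) ^ 2 := by field_simp
  rw [h4]
  field_simp
  ring

/-- The quality of the approximation. -/
lemma arctan_approx (x : ℝ) (hx : 0 ≤ x) (n : ℕ) :
    |Real.arctan (S x (n + 1) / R x (n + 1)) - Real.arctan x / 4| ≤
      25 / 16 * x ^ (2 * (n + 1)+1) * (16 / 49) ^ (n + 1) := by
  have hb : ∀ t ∈ Set.Icc 0 x, ‖((n + 1 : ℝ) ^ 2 - 1 / 16) * t * (t / 4 * (-t ^ 2) ^ n * K n) /
        ((1 + t ^ 2) * (R t (n + 1) ^ 2 + S t (n + 1) ^ 2))‖ ≤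
        25 / 16 * x ^ (2 * (n + 1)) * (16 / 49) ^ (n + 1) := by
    intro t ht
    have e : ((n + 1 : ℝ) ^ 2 - 1 / 16) * t * (t / 4 * (-t ^ 2) ^ n * K n)
      = (-1) ^ n * (t ^ (2 * (n + 1)) / 4 * K (n + 1)) := by
      rw [K, neg_pow]; ring
    have hR := R_pos t (n + 1)
    have hK := K_pos (n + 1)
    have hge := R_ge t (n + 1)
    rw [e, norm_div, norm_mul, norm_pow, norm_neg, norm_one, one_pow, one_mul,
      Real.norm_of_nonneg (by have := ht.1; positivity), Real.norm_of_nonneg (by positivity),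
      div_le_iff₀ (by positivity)]
    have h1 : t ^ (2 * (n + 1)) ≤ x ^ (2 * (n + 1)) := pow_le_pow_left₀ ht.1 ht.2 _
    have h2 : ((2 / 5) * (7 / 4) ^ (n + 1) * ((n + 1).factorial : ℝ)) ^ 2 ≤ R t (n + 1) ^ 2 :=
      pow_le_pow_left₀ (by positivity) hge 2
    have h3 : R t (n + 1) ^ 2 ≤ (1 + t ^ 2) * (R t (n + 1) ^ 2 + S t (n + 1) ^ 2) := by
      nlinarith [mul_nonneg (sq_nonneg t) (sq_nonneg (R t (n + 1))),
        mul_nonneg (sq_nonneg t) (sq_nonneg (S t (n + 1))), sq_nonneg (S t (n + 1))]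
    calc t ^ (2 * (n + 1)) / 4 * K (n + 1)
        ≤ x ^ (2 * (n + 1)) / 4 * ((n + 1).factorial : ℝ) ^ 2 := by
          gcongr
          exact K_le (n + 1)
      _ = 25 / 16 * x ^ (2 * (n + 1)) * (16 / 49) ^ (n + 1) *
          ((2 / 5) * (7 / 4) ^ (n + 1) * ((n + 1).factorial : ℝ)) ^ 2 := by
          have : (16 / 49 : ℝ) ^ (n + 1) * ((7 / 4) ^ (n + 1)) ^ 2 = 1 := by
            rw [← pow_mul, mul_comm (n + 1) 2, pow_mul, ← mul_pow]; norm_num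
          linear_combination (-(1/4) * x ^ (2 * (n + 1)) * ((n + 1).factorial : ℝ) ^ 2) * this
      _ ≤ _ := by
          gcongr
          exact h2.trans h3
  have := (convex_Icc (0 : ℝ) x).norm_image_sub_le_of_norm_hasDerivWithin_le
    (fun t _ => (deriv_arctan t n).hasDerivWithinAt) hb
    (Set.left_mem_Icc.2 hx) (Set.right_mem_Icc.2 hx)
  have hS : S 0 (n + 1) = 0 := by
    have : ∀ n, S 0 n = 0 := by
      intro n
      induction n using Nat.twoStepInduction with
      | zero => rfl
      | one => simp [S]
      | more n h0 h1 => rw [S_succ, h0, h1]; simp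
    exact this _
  simp only [hS, zero_div, Real.arctan_zero, sub_zero] at this
  rw [Real.norm_eq_abs, Real.norm_of_nonneg hx] at this
  refine this.trans (le_of_eq ?_)
  ring

end Ljunggren

namespace Ljunggren

/-- The `z`-coordinates of the solutions of `x ^ 2 - 2 * z ^ 2 = -1`, with the `x`-coordinate. -/
def pell : ℕ → ℕ × ℕ
  | 0 => (1, 1)
  | (n + 1) => let p := pell n; (3 * p.1 + 4 * p.2, 2 * p.1 + 3 * p.2)

lemma pell_complete (z : ℕ) : ∀ x : ℕ, 0 < z → x ^ 2 + 1 = 2 * z ^ 2 → ∃ k, pell k = (x, z) := by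
  induction z using Nat.strong_induction_on with
  | _ z ih =>
    intro x hz h
    by_cases h1 : z = 1
    · refine ⟨0, ?_⟩
      subst h1
      have : x = 1 := by nlinarith
      rw [this]; rfl
    · have hz2 : 2 ≤ z := by omega
      have hxz : z < x := by nlinarith
      have a1 : 4 * z ≤ 3 * x := by nlinarith
      have a2 : 2 * x < 3 * z := by nlinarith
      obtain ⟨u, hu⟩ := Nat.exists_eq_add_of_le a1
      obtain ⟨v, hv⟩ := Nat.exists_eq_add_of_le a2.le
      have e1 : x = 3 * u + 4 * v := by omega
      have e2 : z = 2 * u + 3 * v := by omega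
      obtain ⟨k, hk⟩ := ih v (by omega) u (by omega) (by
        rw [e1, e2] at h; nlinarith)
      refine ⟨k + 1, ?_⟩
      rw [pell, hk, e1, e2]

lemma pell_growth (k : ℕ) : 5 ^ k ≤ (pell k).2 ∧ (pell k).2 ≤ (pell k).1 := by
  induction k with
  | zero => simp [pell]
  | succ k ih =>
    simp only [pell]
    rw [pow_succ]
    omega

lemma pell_mono : Monotone (fun k => (pell k).2) := by
  apply monotone_nat_of_le_succ
  intro n
  simp only [pell]
  omega

lemma pell_check : ∀ k < 96, k = 0 ∨ k = 3 ∨ ∃ p ∈ [37, 137, 47, 3], ∀ r < p,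
    r * r % p ≠ (pell k).2 % p := by
  decide +kernel

lemma pell_big : 31 ^ 48 ≤ (pell 96).2 := by decide +kernel

lemma small (x y : ℕ) (hy : 0 < y) (h : x ^ 2 + 1 = 2 * y ^ 4) (hb : y < 31 ^ 24) :
    (x = 1 ∧ y = 1) ∨ (x = 239 ∧ y = 13) := by
  obtain ⟨k, hk⟩ := pell_complete (y ^ 2) x (by positivity) (by rw [h]; ring)
  have h2 : (pell k).2 = y ^ 2 := by rw [hk]
  have h1 : (pell k).1 = x := by rw [hk]
  have hk' : k < 96 := by
    by_contra hcon
    have := pell_mono (not_lt.1 hcon)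
    have hb2 : y ^ 2 < (31 ^ 24) ^ 2 := Nat.pow_lt_pow_left hb (by norm_num)
    have := pell_big
    simp only at *
    rw [← pow_mul] at hb2
    omega
  rcases pell_check k hk' with rfl | rfl | ⟨p, hp, hr⟩
  · left
    simp [pell] at h1 h2
    exact ⟨h1.symm, by nlinarith⟩
  · right
    norm_num [pell] at h1 h2
    refine ⟨h1.symm, by nlinarith⟩
  · exfalso
    have hp0 : 0 < p := by
      simp at hp; omega
    apply hr (y % p) (Nat.mod_lt _ hp0)
    rw [h2, pow_two, ← Nat.mul_mod]

end Ljunggren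

namespace Ljunggren

lemma asc_prod (r : ℤ) (k : ℕ) : (k.factorial : ℤ) ∣ ∏ i ∈ Finset.range k, (r + i) := by
  have h := Ring.factorial_nsmul_multichoose_eq_ascPochhammer r k
  rw [Polynomial.ascPochhammer_smeval_eq_eval] at h
  have h2 : ∀ k : ℕ, (ascPochhammer ℤ k).eval r = ∏ i ∈ Finset.range k, (r + i) := by
    intro k
    induction k with
    | zero => simp
    | succ k ih => rw [ascPochhammer_succ_eval, Finset.prod_range_succ, ih]
  rw [h2] at h
  exact ⟨Ring.multichoose r k, by rw [← h]; simp⟩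

lemma fact_dvd (s : ℤ) (k : ℕ) :
    (k.factorial : ℤ) ∣ 2 ^ k * ∏ i ∈ Finset.range k, (s - 4 * i) := by
  set e := (k.factorial).factorization 2 with he
  set M := k.factorial / 2 ^ e with hM
  have hkM : 2 ^ e * M = k.factorial := Nat.ordProj_mul_ordCompl_eq_self _ 2
  have hle : e ≤ k := by
    have := sub_one_mul_padicValNat_factorial (p := 2) k
    rw [he, Nat.factorization_def _ Nat.prime_two]
    omega
  have hc : Nat.Coprime 2 M := Nat.coprime_ordCompl Nat.prime_two (Nat.factorial_ne_zero k)
  have hc4 : IsCoprime (4 : ℤ) (M : ℤ) := by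
    have : Nat.Coprime (2 ^ 2) M := Nat.Coprime.pow_left 2 hc
    exact_mod_cast Nat.isCoprime_iff_coprime.2 this
  obtain ⟨u, v, huv⟩ := hc4
  have hMd : (M : ℤ) ∣ ∏ i ∈ Finset.range k, (s - 4 * i) := by
    have h1 : (M : ℤ) ∣ ∏ i ∈ Finset.range k, (-s * u + i) :=
      dvd_trans (by exact_mod_cast Dvd.intro_left _ hkM) (asc_prod (-s * u) k)
    have h2 : (∏ i ∈ Finset.range k, (s - 4 * i)) ≡ ∏ i ∈ Finset.range k, (-4 * (-s * u + i))
        [ZMOD M] := by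
      apply Int.ModEq.prod
      intro i _
      rw [Int.modEq_iff_dvd]
      exact ⟨-s * v, by linear_combination s * huv⟩
    rw [Finset.prod_mul_distrib] at h2
    exact (Int.ModEq.dvd_iff h2).2 (dvd_mul_of_dvd_right h1 _)
  have : ((2 ^ e * M : ℕ) : ℤ) ∣ 2 ^ k * ∏ i ∈ Finset.range k, (s - 4 * i) := by
    push_cast
    exact mul_dvd_mul (pow_dvd_pow 2 hle) hMd
  rwa [hkM] at this

/-- Binomial coefficients with complex upper entry. -/
noncomputable def cb (a : ℂ) (k : ℕ) : ℂ := (∏ i ∈ Finset.range k, (a - i)) / k.factorial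

lemma cb_succ (a : ℂ) (k : ℕ) : (k + 1) * cb a (k + 1) = (a - k) * cb a k := by
  have h1 : (k.factorial : ℂ) ≠ 0 := by exact_mod_cast Nat.factorial_ne_zero k
  have h2 : (k + 1 : ℂ) ≠ 0 := by exact_mod_cast Nat.succ_ne_zero k
  rw [cb, cb, Finset.prod_range_succ, Nat.factorial_succ]
  push_cast
  field_simp

lemma cb_int (s : ℤ) (k : ℕ) : ∃ t : ℤ, 8 ^ k * cb (s / 4) k = t := by
  obtain ⟨t, ht⟩ := fact_dvd s k
  refine ⟨t, ?_⟩
  have h1 : (k.factorial : ℂ) ≠ 0 := by exact_mod_cast Nat.factorial_ne_zero k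
  have h2 : (2 : ℂ) ^ k * ∏ i ∈ Finset.range k, ((s : ℂ) - 4 * i) = k.factorial * t := by
    exact_mod_cast congrArg (Int.cast : ℤ → ℂ) ht
  rw [cb, ← mul_div_assoc, div_eq_iff h1, mul_comm (t : ℂ), ← h2]
  have h3 : ∏ i ∈ Finset.range k, ((s : ℂ) - 4 * i) =
      4 ^ k * ∏ i ∈ Finset.range k, ((s : ℂ) / 4 - i) := by
    rw [← Finset.card_range k, ← Finset.prod_const, Finset.card_range, ← Finset.prod_mul_distrib]
    apply Finset.prod_congr rfl
    intro i _
    ring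
  rw [h3, ← mul_assoc, ← mul_pow]
  norm_num

open PowerSeries

/-- The series `(1 + ξ X) ^ a`. -/
noncomputable def bs (a ξ : ℂ) : PowerSeries ℂ := PowerSeries.mk fun k => cb a k * ξ ^ k

/-- The series `1 + ξ X`. -/
noncomputable def lin (ξ : ℂ) : PowerSeries ℂ := 1 + C ξ * X

lemma bs_deriv (a ξ : ℂ) : lin ξ * derivative ℂ (bs a ξ) = C (a * ξ) * bs a ξ := by
  ext k
  rw [lin, add_mul, one_mul, map_add, coeff_C_mul, coeff_derivative, mul_assoc, coeff_C_mul]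
  cases k with
  | zero =>
    rw [coeff_zero_X_mul]
    have := cb_succ a 0
    simp [bs] at *
    rw [this]; ring
  | succ k =>
    rw [coeff_succ_X_mul, coeff_derivative]
    have := cb_succ a (k + 1)
    simp only [bs, coeff_mk]
    push_cast at *
    linear_combination (ξ ^ (k + 2)) * this

/-- `ξ = 239 + i`. -/
noncomputable def xi : ℂ := 239 + Complex.I
/-- `η = 239 - i`. -/
noncomputable def eta : ℂ := 239 - Complex.I

/-- The generating series `((1 + ξ X) (1 + η X)) ^ n ((1 + ξ X) / (1 + η X)) ^ (1/4)`. -/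
noncomputable def F (n : ℕ) : PowerSeries ℂ :=
  (lin xi * lin eta) ^ n * (bs ((1 : ℤ) / 4) xi * bs ((-1 : ℤ) / 4) eta)

lemma V_eq : lin xi * lin eta = 1 + C 478 * X + C 57122 * X * X := by
  have h1 : xi + eta = 478 := by simp [xi, eta]; ring
  have h2 : xi * eta = 57122 := by
    simp only [xi, eta]; linear_combination (-1) * Complex.I_sq
  rw [← h1, ← h2, lin, lin, map_add, map_mul]
  ring

lemma V_deriv : derivative ℂ (lin xi * lin eta) = C 478 + C (2 * 57122) * X := by
  rw [V_eq]
  ext k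
  rw [coeff_derivative]
  rcases k with _ | _ | k
  · simp [coeff_X, coeff_one, coeff_C, mul_assoc]
  · simp [coeff_X, coeff_one, coeff_C, mul_assoc]
    norm_num
  · simp [coeff_X, coeff_one, coeff_C, mul_assoc]

lemma F_succ (n : ℕ) : F (n + 1) = (lin xi * lin eta) * F n := by
  rw [F, F, pow_succ']; ring

lemma F_deriv (n : ℕ) : (lin xi * lin eta) * derivative ℂ (F n) =
    (C (n : ℂ) * (C 478 + C (2 * 57122) * X) + C (Complex.I / 2)) * F n := by
  induction n with
  | zero =>
    have h1 := bs_deriv ((1 : ℤ) / 4) xi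
    have h2 := bs_deriv ((-1 : ℤ) / 4) eta
    have h3 : C (Complex.I / 2) = C ((1 : ℤ) / 4 * xi) + C ((-1 : ℤ) / 4 * eta) := by
      rw [← map_add]; congr 1; simp [xi, eta]; ring
    have h4 : C ((1 : ℤ) / 4 * xi) * (C eta * X)+ C ((-1 : ℤ) / 4 * eta) * (C xi * X) = 0 := by
      rw [← mul_assoc, ← mul_assoc, ← map_mul, ← map_mul, ← add_mul, ← map_add]
      have : ((1 : ℤ) : ℂ) / 4 * xi * eta + ((-1 : ℤ) : ℂ) / 4 * eta * xi = 0 := by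
        push_cast; ring
      rw [this]; simp
    simp only [F, pow_zero, one_mul, Derivation.leibniz, smul_eq_mul]
    rw [h3]
    simp only [Nat.cast_zero, map_zero, zero_mul, zero_add]
    have e1 : lin eta = 1 + C eta * X := rfl
    have e2 : lin xi = 1 + C xi * X := rfl
    rw [e2] at h1 ⊢
    rw [e1] at h2 ⊢
    linear_combination ((1 + C eta * X) * bs ((-1 : ℤ) / 4) eta) * h1 +
      ((1 + C xi * X) * bs ((1 : ℤ) / 4) xi) * h2 +
      (bs ((1 : ℤ) / 4) xi * bs ((-1 : ℤ) / 4) eta) * h4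
  | succ n ih =>
    rw [F_succ, Derivation.leibniz, smul_eq_mul, smul_eq_mul, V_deriv]
    push_cast
    rw [map_add, map_one]
    linear_combination (lin xi * lin eta) * ih

/-- The coefficients of `F`. -/
noncomputable def e (n k : ℕ) : ℂ := coeff k (F n)

lemma e_r0 (n : ℕ) : e n 1 = (n * 478 + Complex.I / 2) * e n 0 := by
  have h := congrArg (coeff 0) (F_deriv n)
  rw [V_eq] at h
  simp only [add_mul, mul_assoc, map_add, coeff_C_mul, one_mul, coeff_zero_X_mul,
    coeff_derivative] at h
  simp only [e]
  push_cast at h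
  linear_combination h

lemma e_r1 (n j : ℕ) : (j + 2) * e n (j + 2) + 478 * (j + 1) * e n (j + 1) + 57122 * j * e n j =
    (n * 478 + Complex.I / 2) * e n (j + 1) + 2 * n * 57122 * e n j := by
  have h := congrArg (coeff (j + 1)) (F_deriv n)
  rw [V_eq] at h
  simp only [add_mul, mul_add, mul_assoc, map_add, coeff_C_mul, one_mul, coeff_succ_X_mul,
    coeff_derivative] at h
  simp only [e]
  rcases j with _ | j
  · simp only [coeff_zero_X_mul] at h
    push_cast at *
    linear_combination h
  · simp only [coeff_succ_X_mul, coeff_derivative] at h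
    push_cast at *
    linear_combination h

lemma e_s0 (n : ℕ) : e (n + 1) 0 = e n 0 := by
  simp only [e, F_succ, V_eq]
  simp [add_mul, mul_assoc]

lemma e_s1 (n : ℕ) : e (n + 1) 1 = e n 1 + 478 * e n 0 := by
  simp only [e, F_succ, V_eq, add_mul, mul_assoc, map_add, coeff_C_mul, one_mul]
  rw [show (1 : ℕ) = 0 + 1 from rfl, coeff_succ_X_mul, coeff_succ_X_mul, coeff_zero_X_mul]
  ring

lemma e_s2 (n j : ℕ) :
    e (n + 1) (j + 2) = e n (j + 2) + 478 * e n (j + 1) + 57122 * e n j := by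
  simp only [e, F_succ, V_eq, add_mul, mul_assoc, map_add, coeff_C_mul, one_mul,
    coeff_succ_X_mul]

lemma e_P (n : ℕ) : (n + 2) * e (n + 2) (n + 2) =
    ((n + 2) * 478 + Complex.I / 2) * e (n + 1) (n + 1) + 2 * 57122 * (n + 2) * e (n + 1) n := by
  have h1 := e_s2 (n + 1) n
  have h2 := e_r1 (n + 1) n
  push_cast at *
  linear_combination (n + 2 : ℂ) * h1 + h2

lemma e_M (n : ℕ) : (n + 3) * e (n + 2) (n + 1) =
    (n + 3) * (e (n + 1) (n + 1) + 478 * e (n + 1) n) + (n + 1) * e (n + 1) (n + 1)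
      - (478 + Complex.I / 2) * e (n + 1) n := by
  rcases n with _ | n
  · have h1 := e_s1 1
    have h2 := e_r0 1
    push_cast at *
    linear_combination 3 * h1 - h2
  · have h1 := e_s2 (n + 2) n
    have h2 := e_r1 (n + 2) n
    push_cast at *
    linear_combination (n + 4 : ℂ) * h1 - h2

/-- The diagonal coefficients. -/
noncomputable def p (n : ℕ) : ℂ := e n n

lemma p_zero : p 0 = 1 := by simp [p, e, F, bs, cb]

lemma e10 : e 1 0 = 1 := by rw [e_s0]; exact p_zero

lemma p_one : p 1 = 478 + Complex.I / 2 := by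
  rw [p, e_r0, e10]; push_cast; ring

lemma p_rec (n : ℕ) : (n + 2) * (n + 1) * p (n + 2) =
    478 * (2 * n + 3) * (n + 1) * p (n + 1) + 4 * ((n + 1) ^ 2 - 1 / 16) * p n := by
  rcases n with _ | n
  · have h := e_P 0
    have h1 : e 1 1 = _ := p_one
    have h2 : e 2 2 = p 2 := rfl
    simp only [zero_add] at *
    rw [h1, e10, h2] at h
    rw [p_one, p_zero]
    push_cast at *
    linear_combination h + (1 / 4) * Complex.I_sq
  · have h1 := e_P (n + 1)
    have h2 := e_P n
    have h3 := e_M n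
    simp only [p]
    push_cast at *
    rw [show n + 1 + 1 = n + 2 from rfl] at *
    rw [show n + 1 + 2 = n + 3 from rfl] at *
    linear_combination (n + 2 : ℂ) * h1 + 2 * 57122 * (n + 2 : ℂ) * h3
      - ((n + 2 : ℂ) * 478 - Complex.I / 2) * h2 + (1 / 4) * e (n + 1) (n + 1) * Complex.I_sq

/-- Integrality: `8 ^ k` times the `k`-th coefficient is a Gaussian integer divisible by
`(1 + i) ^ k`. -/
def Gd (f : PowerSeries ℂ) : Prop :=
  ∀ k, ∃ z : GaussianInt, 8 ^ k * coeff k f = (1 + Complex.I) ^ k * GaussianInt.toComplex z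

lemma Gd.mul {f g : PowerSeries ℂ} (hf : Gd f) (hg : Gd g) : Gd (f * g) := by
  choose u hu using hf
  choose v hv using hg
  intro k
  refine ⟨∑ q ∈ Finset.HasAntidiagonal.antidiagonal k, u q.1 * v q.2, ?_⟩
  rw [coeff_mul, map_sum, Finset.mul_sum, Finset.mul_sum]
  apply Finset.sum_congr rfl
  intro q hq
  rw [← Finset.HasAntidiagonal.mem_antidiagonal.1 hq, map_mul, pow_add, pow_add]
  linear_combination (8 ^ q.2 * coeff q.2 g) * hu q.1 +
    ((1 + Complex.I) ^ q.1 * GaussianInt.toComplex (u q.1)) * hv q.2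

lemma Gd.one : Gd 1 := by
  intro k
  rcases k with _ | k
  · exact ⟨1, by simp⟩
  · exact ⟨0, by simp [coeff_one]⟩

lemma Gd.pow {f : PowerSeries ℂ} (hf : Gd f) (n : ℕ) : Gd (f ^ n) := by
  induction n with
  | zero => rw [pow_zero]; exact Gd.one
  | succ n ih => rw [pow_succ]; exact ih.mul hf

lemma Gd.bs (s : ℤ) (ξ : ℂ) (z : GaussianInt)
    (h : ξ = (1 + Complex.I) * GaussianInt.toComplex z) : Gd (bs (s / 4) ξ) := by
  intro k
  obtain ⟨t, ht⟩ := cb_int s k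
  refine ⟨t * z ^ k, ?_⟩
  rw [Ljunggren.bs, coeff_mk, ← mul_assoc, ht, h, mul_pow, map_mul, map_pow, map_intCast]
  ring

lemma Gd.lin (ξ : ℂ) (z : GaussianInt)
    (h : ξ = (1 + Complex.I) * GaussianInt.toComplex z) : Gd (lin ξ) := by
  intro k
  rcases k with _ | _ | k
  · exact ⟨1, by simp [Ljunggren.lin]⟩
  · refine ⟨8 * z, ?_⟩
    have : coeff (0 + 1) (Ljunggren.lin ξ) = ξ := by
      simp [Ljunggren.lin, coeff_one]
    rw [this, h, map_mul, map_ofNat]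
    ring
  · exact ⟨0, by simp [Ljunggren.lin, coeff_one, coeff_X]⟩

lemma xi_eq : xi = (1 + Complex.I) * GaussianInt.toComplex ⟨120, -119⟩ := by
  rw [GaussianInt.toComplex_def', xi]
  push_cast
  linear_combination 119 * Complex.I_sq

lemma eta_eq : eta = (1 + Complex.I) * GaussianInt.toComplex ⟨119, -120⟩ := by
  rw [GaussianInt.toComplex_def', eta]
  push_cast
  linear_combination 120 * Complex.I_sq

lemma Gd_F (n : ℕ) : Gd (F n) :=
  (((Gd.lin _ _ xi_eq).mul (Gd.lin _ _ eta_eq)).pow n).mul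
    ((Gd.bs 1 _ _ xi_eq).mul (Gd.bs (-1) _ _ eta_eq))

lemma p_int (n : ℕ) :
    ∃ z : GaussianInt, 8 ^ n * p n = (1 + Complex.I) ^ n * GaussianInt.toComplex z := Gd_F n n

lemma p_norm (n : ℕ) : ‖p n‖ ≤ 957 ^ n := by
  induction n using Nat.twoStepInduction with
  | zero => rw [p_zero]; simp
  | one =>
    rw [p_one, pow_one]
    refine (norm_add_le _ _).trans ?_
    rw [norm_div, Complex.norm_I]
    norm_num
  | more n h0 h1 =>
    have h := congrArg norm (p_rec n)
    have e1 : ‖((n : ℂ) + 2) * (n + 1) * p (n + 2)‖ = (n + 2) * (n + 1) * ‖p (n + 2)‖ := by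
      rw [norm_mul, show ((n : ℂ) + 2) * (n + 1) = (((n + 2) * (n + 1) : ℕ) : ℂ) by push_cast; ring,
        Complex.norm_natCast]
      push_cast; ring
    have e2 : ‖478 * (2 * (n : ℂ) + 3) * (n + 1) * p (n + 1)‖ =
        478 * (2 * n + 3) * (n + 1) * ‖p (n + 1)‖ := by
      rw [norm_mul, show 478 * (2 * (n : ℂ) + 3) * (n + 1) =
        ((478 * (2 * n + 3) * (n + 1) : ℕ) : ℂ) by push_cast; ring, Complex.norm_natCast]
      push_cast; ring
    have e3 : ‖4 * (((n : ℂ) + 1) ^ 2 - 1 / 16) * p n‖ =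
        4 * (((n : ℝ) + 1) ^ 2 - 1 / 16) * ‖p n‖ := by
      rw [norm_mul, show 4 * (((n : ℂ) + 1) ^ 2 - 1 / 16) =
        ((4 * (((n : ℝ) + 1) ^ 2 - 1 / 16) : ℝ) : ℂ) by push_cast; ring, Complex.norm_real,
        Real.norm_of_nonneg]
      have : (0 : ℝ) ≤ n := n.cast_nonneg
      nlinarith
    have h2 := norm_add_le (478 * (2 * (n : ℂ) + 3) * (n + 1) * p (n + 1))
      (4 * (((n : ℂ) + 1) ^ 2 - 1 / 16) * p n)
    rw [← h, e1, e2, e3] at h2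
    have hn : (0 : ℝ) ≤ n := n.cast_nonneg
    have hK : (0 : ℝ) ≤ ((n : ℝ) + 1) ^ 2 - 1 / 16 := by nlinarith
    have h3 : ((n : ℝ) + 2) * (n + 1) * ‖p (n + 2)‖ ≤ ((n : ℝ) + 2) * (n + 1) * 957 ^ (n + 2) := by
      refine h2.trans ?_
      calc _ ≤ 478 * (2 * (n : ℝ) + 3) * (n + 1) * 957 ^ (n + 1) +
            4 * (((n : ℝ) + 1) ^ 2 - 1 / 16) * 957 ^ n := by gcongr
        _ = (478 * (2 * (n : ℝ) + 3) * (n + 1) * 957 +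
            4 * (((n : ℝ) + 1) ^ 2 - 1 / 16)) * 957 ^ n := by ring
        _ ≤ (((n : ℝ) + 2) * (n + 1) * 957 ^ 2) * 957 ^ n := by
            gcongr
            nlinarith
        _ = _ := by ring
    exact le_of_mul_le_mul_left h3 (by positivity)

lemma p_eq (n : ℕ) : (n.factorial : ℂ) * p n =
    478 ^ n * ((R (1 / 239) n : ℂ) + (S (1 / 239) n : ℂ) * Complex.I) := by
  induction n using Nat.twoStepInduction with
  | zero => rw [p_zero]; simp [R, S]
  | one => rw [p_one]; simp [R, S]; ring
  | more n h0 h1 =>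
    have h := p_rec n
    rw [R_succ, S_succ, Nat.factorial_succ, Nat.factorial_succ]
    rw [Nat.factorial_succ] at h1
    push_cast at *
    linear_combination (n.factorial : ℂ) * h + 478 * (2 * n + 3 : ℂ) * h1 +
      4 * ((n + 1 : ℂ) ^ 2 - 1 / 16) * h0

end Ljunggren

namespace Ljunggren

lemma gauss (x y : ℤ) (h : x ^ 2 + 1 = 2 * y ^ 4) :
    ∃ (b : GaussianInt) (s : ℤ), (s = 1 ∨ s = -1) ∧
      (2 * b ^ 4 = (⟨x, s⟩ : GaussianInt) * ⟨239, -1⟩ ∨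
        b ^ 4 = 2 * (⟨x, s⟩ : GaussianInt) * ⟨239, -1⟩) := by
  have hodd : ∃ m, x = 2 * m + 1 := by
    rcases Int.even_or_odd x with ⟨m, hm⟩ | ⟨m, hm⟩
    · exfalso
      have : 2 * (2 * m ^ 2 - y ^ 4) = -1 := by rw [hm] at h; linarith [h]
      omega
    · exact ⟨m, hm⟩
  obtain ⟨m, hm⟩ := hodd
  have hm4 : (m + 1) ^ 2 + m ^ 2 = y ^ 4 := by rw [hm] at h; linarith
  set g : GaussianInt := ⟨m + 1, -m⟩ with hg
  set g' : GaussianInt := ⟨m + 1, m⟩ with hg'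
  have hprod : g * g' = ((y : ℤ) : GaussianInt) ^ 4 := by
    rw [← Int.cast_pow, ← hm4]
    ext
    · rw [Zsqrtd.re_intCast]; simp [hg, hg']; ring
    · rw [Zsqrtd.im_intCast]; simp [hg, hg']; ring
  have hcop : IsCoprime g g' := by
    refine ⟨g' - ((m ^ 2 + m : ℤ) : GaussianInt) * ⟨1, -1⟩,
      - ((m ^ 2 + m : ℤ) : GaussianInt) * ⟨1, 1⟩, ?_⟩
    ext
    · simp [hg, hg', pow_two]; ring
    · simp [hg, hg', pow_two]; ring
  obtain ⟨a, u, hu⟩ := exists_associated_pow_of_mul_eq_pow' hcop hprod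
  have hx1 : (⟨x, 1⟩ : GaussianInt) = ⟨1, 1⟩ * g := by
    rw [hm]; ext <;> simp [hg] ; ring
  have hx2 : (⟨x, -1⟩ : GaussianInt) = ⟨1, -1⟩ * star g := by
    rw [hm]; ext <;> simp [hg] ; ring
  have h239 : (⟨239, -1⟩ : GaussianInt) = -⟨1, 1⟩ * ⟨3, 2⟩ ^ 4 := by
    decide +kernel
  have h4 : (⟨1, 1⟩ : GaussianInt) ^ 4 = -4 := by decide +kernel
  have h11 : (⟨1, 1⟩ : GaussianInt) * ⟨1, 1⟩ = 2 * ⟨0, 1⟩ := by decide +kernel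
  have h12 : (⟨1, 1⟩ : GaussianInt) * ⟨1, -1⟩ = 2 := by decide +kernel
  have hii : (⟨0, 1⟩ : GaussianInt) * ⟨0, 1⟩ = -1 := by decide +kernel
  have hunit : (u : GaussianInt) = 1 ∨ (u : GaussianInt) = -1 ∨ (u : GaussianInt) = ⟨0, 1⟩ ∨
      (u : GaussianInt) = -⟨0, 1⟩ := by
    have hn : (u : GaussianInt).norm = 1 :=
      (Zsqrtd.norm_eq_one_iff' (by norm_num) _).2 u.isUnit
    generalize (u : GaussianInt) = v at hn ⊢
    obtain ⟨c, d⟩ := v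
    simp only [Zsqrtd.norm_def] at hn
    have hc := abs_le.1 ((sq_le_one_iff_abs_le_one c).1 (by nlinarith [sq_nonneg d]))
    have hd := abs_le.1 ((sq_le_one_iff_abs_le_one d).1 (by nlinarith [sq_nonneg c]))
    obtain ⟨hc1, hc2⟩ := hc
    obtain ⟨hd1, hd2⟩ := hd
    interval_cases c <;> interval_cases d <;> simp at hn <;> simp [Zsqrtd.ext_iff]
  rcases hunit with h1 | h1 | h1 | h1
  · rw [h1] at hu
    refine ⟨⟨1, 1⟩ * star a * ⟨3, 2⟩, -1, Or.inr rfl, Or.inr ?_⟩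
    rw [hx2, h239, ← hu, star_mul', star_one, star_pow]
    rw [mul_pow, mul_pow, h4]
    linear_combination (2 * star a ^ 4 * (⟨3, 2⟩ : GaussianInt) ^ 4) * h12
  · rw [h1] at hu
    refine ⟨star a * ⟨3, 2⟩, -1, Or.inr rfl, Or.inl ?_⟩
    rw [hx2, h239, ← hu, star_mul', star_neg, star_one, star_pow]
    linear_combination (-star a ^ 4 * (⟨3, 2⟩ : GaussianInt) ^ 4) * h12
  · rw [h1] at hu
    refine ⟨a * ⟨3, 2⟩, 1, Or.inl rfl, Or.inl ?_⟩
    rw [hx1, h239, ← hu]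
    linear_combination (a ^ 4 * (⟨3, 2⟩ : GaussianInt) ^ 4 * ⟨0, 1⟩) * h11 +
      (2 * a ^ 4 * (⟨3, 2⟩ : GaussianInt) ^ 4) * hii
  · rw [h1] at hu
    refine ⟨⟨1, 1⟩ * a * ⟨3, 2⟩, 1, Or.inl rfl, Or.inr ?_⟩
    rw [hx1, h239, ← hu]
    rw [mul_pow, mul_pow, h4]
    linear_combination (-2 * a ^ 4 * (⟨3, 2⟩ : GaussianInt) ^ 4 * ⟨0, 1⟩) * h11 -
      (4 * a ^ 4 * (⟨3, 2⟩ : GaussianInt) ^ 4) * hii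

/-- Rotating by a power of `i` we may assume that the argument is in `(-π/4, π/4)`. -/
lemma rotate (b : GaussianInt) (hb : 0 < (b ^ 4).re) :
    ∃ c : GaussianInt, c ^ 4 = b ^ 4 ∧ |c.im| < c.re := by
  have hi : (⟨0, 1⟩ : GaussianInt) ^ 4 = 1 := by decide +kernel
  have hre : (b ^ 4).re = (b.re ^ 2 - b.im ^ 2) ^ 2 - 4 * b.re ^ 2 * b.im ^ 2 := by
    simp [pow_succ]; ring
  have hne : |b.re| ≠ |b.im| := by
    intro h
    have h2 : b.re ^ 2 = b.im ^ 2 := by rw [← sq_abs, h, sq_abs]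
    rw [hre, h2] at hb
    nlinarith [sq_nonneg (b.im ^ 2)]
  rcases lt_or_gt_of_ne hne with h | h
  · rcases le_or_gt 0 b.im with h0 | h0
    · refine ⟨-⟨0, 1⟩ * b, ?_, ?_⟩
      · rw [mul_pow, neg_pow, hi]; ring
      · simp
        rwa [abs_of_nonneg h0] at h
    · refine ⟨⟨0, 1⟩ * b, ?_, ?_⟩
      · rw [mul_pow, hi]; ring
      · simp
        rwa [abs_of_neg h0] at h
  · rcases le_or_gt 0 b.re with h0 | h0
    · exact ⟨b, rfl, by rwa [abs_of_nonneg h0] at h⟩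
    · refine ⟨-b, by ring, ?_⟩
      simp
      rwa [abs_of_neg h0] at h

lemma polar (a b : ℝ) (ha : 0 < a) : ∃ r : ℝ, 0 < r ∧ r ^ 2 = a ^ 2 + b ^ 2 ∧
    a = r * Real.cos (Real.arctan (b / a)) ∧ b = r * Real.sin (Real.arctan (b / a)) := by
  have h0 : 0 < a ^ 2 + b ^ 2 := by positivity
  have h1 : Real.sqrt (1 + (b / a) ^ 2) = Real.sqrt (a ^ 2 + b ^ 2) / a := by
    rw [show 1 + (b / a) ^ 2 = (a ^ 2 + b ^ 2) / a ^ 2 by field_simp, Real.sqrt_div h0.le,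
      Real.sqrt_sq ha.le]
  have h2 := Real.sqrt_pos.2 h0
  refine ⟨Real.sqrt (a ^ 2 + b ^ 2), h2, Real.sq_sqrt h0.le, ?_, ?_⟩
  · rw [Real.cos_arctan, h1]; field_simp
  · rw [Real.sin_arctan, h1]; field_simp

lemma polarC (a b : ℝ) (ha : 0 < a) : ∃ r : ℝ, 0 < r ∧
    (a + b * Complex.I : ℂ) = r * Complex.exp (Real.arctan (b / a) * Complex.I) := by
  obtain ⟨r, h0, -, h1, h2⟩ := polar a b ha
  refine ⟨r, h0, ?_⟩
  rw [Complex.exp_mul_I, ← Complex.ofReal_cos, ← Complex.ofReal_sin]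
  set t := Real.arctan (b / a)
  rw [h1, h2]
  push_cast
  ring

lemma arctan_small (a b : ℝ) (ha : 0 < a) (h : |b| < a) : |Real.arctan (b / a)| < Real.pi / 4 := by
  have h1 : |b / a| < 1 := by rw [abs_div, abs_of_pos ha, div_lt_one ha]; exact h
  rw [abs_lt] at *
  rw [← Real.arctan_one, ← Real.arctan_neg]
  exact ⟨Real.arctan_strictMono h1.1, Real.arctan_strictMono h1.2⟩

lemma angle (x b1 b2 s c : ℝ) (hx : 1 < x) (hb : |b2| < b1) (hs : s = 1 ∨ s = -1) (hc : 0 < c)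
    (h : (b1 + b2 * Complex.I : ℂ) ^ 4 = c * ((x + s * Complex.I) * (239 - Complex.I))) :
    4 * Real.arctan (b2 / b1) = Real.arctan (s / x) - Real.arctan (1 / 239) := by
  have hb1 : 0 < b1 := (abs_nonneg _).trans_lt hb
  obtain ⟨r, hr, e1⟩ := polarC b1 b2 hb1
  obtain ⟨q, hq, e2⟩ := polarC x s (by linarith)
  obtain ⟨w, hw, e3⟩ := polarC 239 (-1) (by norm_num)
  have f1 := arctan_small b1 b2 hb1 hb
  have f2 := arctan_small x s (by linarith) (by rcases hs with rfl | rfl <;> simpa using hx)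
  have f3 := arctan_small 239 (-1) (by norm_num) (by norm_num)
  have e3' : (239 - Complex.I : ℂ) = w * Complex.exp (Real.arctan (-1 / 239) * Complex.I) := by
    rw [← e3]; push_cast; ring
  rw [e1, e2, e3'] at h
  have hA : (r * Complex.exp (Real.arctan (b2 / b1) * Complex.I)) ^ 4 =
      ((r ^ 4 : ℝ) : ℂ) * Complex.exp ((4 * Real.arctan (b2 / b1) : ℝ) * Complex.I) := by
    rw [mul_pow, ← Complex.exp_nat_mul]; push_cast; ring_nf
  have hB : (c * (q * Complex.exp (Real.arctan (s / x) * Complex.I) *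
      (w * Complex.exp (Real.arctan (-1 / 239) * Complex.I))) : ℂ) =
      ((c * q * w : ℝ) : ℂ) *
        Complex.exp ((Real.arctan (s / x) + Real.arctan (-1 / 239) : ℝ) * Complex.I) := by
    push_cast
    rw [add_mul, Complex.exp_add]
    ring
  rw [hA, hB, Complex.exp_mul_I, Complex.exp_mul_I] at h
  have h2 := congrArg Complex.arg h
  rw [abs_lt] at f1 f2 f3
  rw [Complex.arg_mul_cos_add_sin_mul_I (by positivity) ⟨by linarith, by linarith⟩,
    Complex.arg_mul_cos_add_sin_mul_I (by positivity) ⟨by linarith, by linarith⟩] at h2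
  rw [h2, show (-1 / 239 : ℝ) = -(1 / 239) by norm_num, Real.arctan_neg]
  ring

end Ljunggren

namespace Ljunggren

lemma lower (n : ℕ) (c : GaussianInt)
    (h : (8 ^ n * p n * GaussianInt.toComplex c).im ≠ 0) :
    (7 / 5 : ℝ) ^ n / 2 ≤ |(8 ^ n * p n * GaussianInt.toComplex c).im| := by
  obtain ⟨z, hz⟩ := p_int n
  set w := 8 ^ n * p n * GaussianInt.toComplex c with hw
  have h1 : w - (starRingEnd ℂ) w = (1 + Complex.I) ^ n *
      GaussianInt.toComplex (z * c - (-⟨0, 1⟩) ^ n * star (z * c)) := by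
    have hI : GaussianInt.toComplex ⟨0, 1⟩ = Complex.I := by
      simp [GaussianInt.toComplex_def]
    have hc : (1 - Complex.I : ℂ) = (1 + Complex.I) * (-Complex.I) := by
      linear_combination Complex.I_mul_I
    rw [hw, hz]
    simp only [map_mul, map_sub, map_pow, map_neg, map_add, map_one, Complex.conj_I,
      GaussianInt.toComplex_star, hI]
    rw [← sub_eq_add_neg, hc, mul_pow]
    ring
  have h2 : w - (starRingEnd ℂ) w = ((2 * w.im : ℝ) : ℂ) * Complex.I := Complex.sub_conj w
  set v := z * c - (-⟨0, 1⟩) ^ n * star (z * c) with hv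
  have hv0 : v ≠ 0 := by
    intro h0
    rw [h0, map_zero, mul_zero, h2] at h1
    have h3 : 2 * w.im = 0 := by
      have := congrArg Complex.im h1
      simpa using this
    exact h (by linarith)
  have hvn : 1 ≤ Complex.normSq (GaussianInt.toComplex v) := by
    rw [← GaussianInt.intCast_real_norm]
    have : 0 < Zsqrtd.norm v := GaussianInt.norm_pos.2 hv0
    exact_mod_cast this
  have h3 := congrArg Complex.normSq (h2.symm.trans h1)
  rw [map_mul, map_mul, map_pow, Complex.normSq_ofReal, Complex.normSq_I] at h3
  have h4 : Complex.normSq (1 + Complex.I) = 2 := by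
    rw [Complex.normSq_apply]; simp; norm_num
  rw [h4] at h3
  have h5 : ((7 / 5 : ℝ) ^ n) ^ 2 ≤ 2 ^ n := by
    rw [← pow_mul, mul_comm, pow_mul]
    exact pow_le_pow_left₀ (by norm_num) (by norm_num) n
  have h6 : (2 : ℝ) ^ n ≤ (2 * |w.im|) ^ 2 := by
    rw [mul_pow, sq_abs]
    have : (0 : ℝ) < 2 ^ n := by positivity
    nlinarith
  have h7 := abs_le_of_sq_le_sq (h5.trans h6) (by positivity)
  have h8 := le_of_abs_le h7
  linarith

lemma upper (n : ℕ) (b1 b2 : ℝ) (hb : 0 < b1) :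
    |(8 ^ n * p n * (b1 + b2 * Complex.I)).im| ≤ 7656 ^ n * ‖(b1 + b2 * Complex.I : ℂ)‖ *
      |Real.arctan (S (1 / 239) n / R (1 / 239) n) + Real.arctan (b2 / b1)| := by
  obtain ⟨r, hr, e1⟩ := polarC _ (S (1 / 239) n) (R_pos (1 / 239) n)
  obtain ⟨q, hq, e2⟩ := polarC b1 b2 hb
  set t := Real.arctan (S (1 / 239) n / R (1 / 239) n)
  set f := Real.arctan (b2 / b1)
  have hp := p_eq n
  have hf : (n.factorial : ℂ) ≠ 0 := by exact_mod_cast n.factorial_ne_zero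
  have hp2 : 8 ^ n * p n = ((8 ^ n * (478 ^ n * r / n.factorial) : ℝ) : ℂ) *
      Complex.exp (t * Complex.I) := by
    rw [e1] at hp
    push_cast
    field_simp
    linear_combination hp
  have hn : ‖8 ^ n * p n‖ ≤ 7656 ^ n := by
    rw [norm_mul, norm_pow, show (7656 : ℝ) = 8 * 957 by norm_num, mul_pow]
    have := p_norm n
    simp only [Complex.norm_ofNat]
    gcongr
  have key : ‖8 ^ n * p n‖ = 8 ^ n * (478 ^ n * r / n.factorial) := by
    rw [hp2, norm_mul, Complex.norm_exp_ofReal_mul_I, mul_one, Complex.norm_real,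
      Real.norm_of_nonneg (by positivity)]
  have key2 : ‖(b1 + b2 * Complex.I : ℂ)‖ = q := by
    rw [e2, norm_mul, Complex.norm_exp_ofReal_mul_I, mul_one, Complex.norm_real,
      Real.norm_of_nonneg hq.le]
  rw [key2]
  rw [key] at hn
  set C := 8 ^ n * (478 ^ n * r / n.factorial)
  have hC : 0 ≤ C := by positivity
  have h3 : 8 ^ n * p n * (b1 + b2 * Complex.I) =
      ((C * q : ℝ) : ℂ) * Complex.exp ((t + f : ℝ) * Complex.I) := by
    rw [hp2, e2]
    push_cast
    rw [add_mul, Complex.exp_add]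
    ring
  rw [h3, Complex.im_ofReal_mul, Complex.exp_ofReal_mul_I_im, abs_mul,
    abs_of_nonneg (by positivity)]
  have := Real.abs_sin_le_abs (x := t + f)
  gcongr

lemma nonvanish (n : ℕ) (b1 b2 : ℝ) (hb : 0 < b1)
    (h1 : (8 ^ n * p n * (b1 + b2 * Complex.I)).im = 0)
    (h2 : (8 ^ (n + 1) * p (n + 1) * (b1 + b2 * Complex.I)).im = 0) : False := by
  have aux (m : ℕ) (h : (8 ^ m * p m * (b1 + b2 * Complex.I)).im = 0) :
      R (1 / 239) m * b2 + S (1 / 239) m * b1 = 0 := by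
    have hp := p_eq m
    have hf : (m.factorial : ℂ) ≠ 0 := by exact_mod_cast m.factorial_ne_zero
    have e : 8 ^ m * p m * (b1 + b2 * Complex.I) = ((8 ^ m * 478 ^ m / m.factorial : ℝ) : ℂ) *
        (((R (1 / 239) m * b1 - S (1 / 239) m * b2 : ℝ) : ℂ) +
          ((R (1 / 239) m * b2 + S (1 / 239) m * b1 : ℝ) : ℂ) * Complex.I) := by
      push_cast
      field_simp
      linear_combination (b1 + b2 * Complex.I) * hp +
        478 ^ m * (S (1 / 239) m * b2) * Complex.I_mul_I
    rw [e, Complex.im_ofReal_mul] at h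
    have h0 : (8 ^ m * 478 ^ m / m.factorial : ℝ) ≠ 0 := by positivity
    have h1 := (mul_eq_zero.1 h).resolve_left h0
    simpa using h1
  have g1 := aux n h1
  have g2 := aux (n + 1) h2
  have d := det_eq (1 / 239) n
  have h3 : (1 / 239 / 4 * (-(1 / 239 : ℝ) ^ 2) ^ n * K n) * b1 = 0 := by
    rw [← d]
    linear_combination R (1 / 239) n * g2 - R (1 / 239) (n + 1) * g1
  have := K_pos n
  have h4 : (-(1 / 239 : ℝ) ^ 2) ^ n ≠ 0 := by apply pow_ne_zero; norm_num
  have h5 : (1 / 239 / 4 * (-(1 / 239 : ℝ) ^ 2) ^ n * K n) * b1 ≠ 0 := by positivity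
  exact h5 h3

lemma numeric (M n : ℕ) (Y x : ℝ) (hM : 12 ≤ M) (h1 : (31 : ℝ) ^ M ≤ Y)
    (h2 : Y < 31 ^ (M + 1)) (hx : Y ^ 4 ≤ x) (hn : n = M ∨ n = M + 1) :
    7656 ^ (n + 1) * (51 / 10 * Y) * (25 / 16 * (1 / 239) ^ (2 * (n + 1) + 1) * (16 / 49) ^ (n + 1)
      + 1 / (4 * x)) < (7 / 5 : ℝ) ^ (n + 1) / 2 := by
  have hY : 0 < Y := lt_of_lt_of_le (by positivity) h1
  have hpos : (0 : ℝ) < (7 / 5) ^ (n + 1) := by positivity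
  have t1 : 7656 ^ (n + 1) * (51 / 10 * Y) *
      (25 / 16 * (1 / 239) ^ (2 * (n + 1) + 1) * (16 / 49) ^ (n + 1)) ≤
      (7 / 5 : ℝ) ^ (n + 1) / 8 := by
    have hY2 : Y ≤ 31 ^ (n + 1) := h2.le.trans (pow_le_pow_right₀ (by norm_num) (by omega))
    calc 7656 ^ (n + 1) * (51 / 10 * Y) *
      (25 / 16 * (1 / 239) ^ (2 * (n + 1) + 1) * (16 / 49) ^ (n + 1))
        ≤ 7656 ^ (n + 1) * (51 / 10 * 31 ^ (n + 1)) *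
      (25 / 16 * (1 / 239) ^ (2 * (n + 1) + 1) * (16 / 49) ^ (n + 1)) := by gcongr
      _ = (51 / 10 * (25 / 16) * (1 / 239)) * (7656 * 31 * (1 / 239) ^ 2 * (16 / 49)) ^ (n + 1) := by
        rw [pow_succ (1 / 239 : ℝ) (2 * (n + 1)), pow_mul]
        simp only [mul_pow]
        ring
      _ ≤ 1 / 8 * (7 / 5) ^ (n + 1) := by
        gcongr
        · norm_num
        · norm_num
      _ = _ := by ring
  have t2 : 7656 ^ (n + 1) * (51 / 10 * Y) * (1 / (4 * x)) ≤ (7 / 5 : ℝ) ^ (n + 1) / 8 := by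
    have hx0 : 0 < x := lt_of_lt_of_le (by positivity) hx
    have a1 : 7656 ^ (n + 1) * (51 / 10 * Y) * (1 / (4 * x)) ≤
        7656 ^ (n + 1) * (51 / 10 * Y) * (1 / (4 * Y ^ 4)) := by gcongr
    refine a1.trans ?_
    have a2 : 7656 ^ (n + 1) * (51 / 10 * Y) * (1 / (4 * Y ^ 4)) =
        7656 ^ (n + 1) * (51 / 40) / Y ^ 3 := by field_simp; norm_num
    rw [a2, div_le_iff₀ (by positivity)]
    have a3 : ((31 : ℝ) ^ M) ^ 3 ≤ Y ^ 3 := pow_le_pow_left₀ (by positivity) h1 3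
    have a4 : 7656 ^ (n + 1) * (51 / 40) ≤ (7 / 5 : ℝ) ^ (n + 1) / 8 * ((31 : ℝ) ^ M) ^ 3 := by
      obtain ⟨k, rfl⟩ := Nat.exists_eq_add_of_le hM
      have base : (7656 : ℝ) ^ k ≤ ((7 / 5) * 31 ^ 3) ^ k :=
        pow_le_pow_left₀ (by norm_num) (by norm_num) k
      have e3 : ((31 : ℝ) ^ (12 + k)) ^ 3 = 31 ^ 36 * (31 ^ 3) ^ k := by
        rw [← pow_mul, ← pow_mul, ← pow_add]; congr 1; ring
      rw [e3]
      rw [mul_pow] at base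
      have hk : (0 : ℝ) < 7656 ^ k := by positivity
      rcases hn with rfl | rfl
      · rw [show 12 + k + 1 = k + 13 by ring, pow_add, pow_add]
        nlinarith
      · rw [show 12 + k + 1 + 1 = k + 14 by ring, pow_add, pow_add]
        nlinarith
    refine a4.trans ?_
    gcongr
  rw [mul_add]
  linarith

lemma abs_arctan_le (t : ℝ) : |Real.arctan t| ≤ |t| := by
  have aux (u : ℝ) (hu : 0 ≤ u) : Real.arctan u ≤ u := by
    have h1 := Real.le_tan (Real.arctan_nonneg.2 hu) (Real.arctan_lt_pi_div_two u)
    rwa [Real.tan_arctan] at h1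
  rcases le_total 0 t with h | h
  · rw [abs_of_nonneg h, abs_of_nonneg (Real.arctan_nonneg.2 h)]
    exact aux t h
  · have := aux (-t) (by linarith)
    rw [Real.arctan_neg] at this
    have h2 := Real.arctan_nonneg.2 (neg_nonneg.2 h)
    rw [Real.arctan_neg] at h2
    rw [abs_of_nonpos h, abs_of_nonpos (by linarith)]
    exact this

lemma large (x y : ℤ) (hx : 0 < x) (hy : (31 : ℤ) ^ 24 ≤ y) (h : x ^ 2 + 1 = 2 * y ^ 4) : False := by
  have hy0 : 0 < y := lt_of_lt_of_le (by positivity) hy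
  have hy1 : 1 < y := lt_of_lt_of_le (by norm_num) hy
  have hxy : y ^ 2 ≤ x := by
    apply le_of_sq_le_sq _ hx.le
    nlinarith [pow_pos hy0 4]
  have hx1 : 1 < x := by nlinarith
  obtain ⟨b, s, hs, hbs⟩ := gauss x y h
  have hs' : -1 ≤ s ∧ s ≤ 1 := by rcases hs with rfl | rfl <;> norm_num
  have hre : 0 < (b ^ 4).re := by
    rcases hbs with hb | hb
    · have := congrArg Zsqrtd.re hb
      rw [two_mul, Zsqrtd.re_add, Zsqrtd.re_mul] at this
      dsimp only at this
      linarith [hs'.1]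
    · rw [hb, mul_assoc, two_mul, Zsqrtd.re_add, Zsqrtd.re_mul]
      dsimp only
      linarith [hs'.1]
  obtain ⟨c, hc, hcb⟩ := rotate b hre
  rw [← hc] at hbs
  have hc0 : (0 : ℝ) < c.re := by
    have := (abs_nonneg _).trans_lt hcb
    exact_mod_cast this
  have hcb' : |(c.im : ℝ)| < c.re := by exact_mod_cast hcb
  have hcc : GaussianInt.toComplex c = ((c.re : ℝ) : ℂ) + ((c.im : ℝ) : ℂ) * Complex.I := by
    rw [GaussianInt.toComplex_def, Complex.ofReal_intCast, Complex.ofReal_intCast]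
  obtain ⟨k, hk0, hk2, hk⟩ : ∃ k : ℝ, 0 < k ∧ k ≤ 2 ∧
      (((c.re : ℝ) : ℂ) + ((c.im : ℝ) : ℂ) * Complex.I) ^ 4 =
        k * ((((x : ℝ) : ℂ) + ((s : ℝ) : ℂ) * Complex.I) * (239 - Complex.I)) := by
    have e239 : GaussianInt.toComplex ⟨239, -1⟩ = 239 - Complex.I := by
      simp [GaussianInt.toComplex_def]; ring
    have ex : GaussianInt.toComplex ⟨x, s⟩ = ((x : ℝ) : ℂ) + ((s : ℝ) : ℂ) * Complex.I := by
      simp [GaussianInt.toComplex_def]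
    rw [← hcc, ← e239, ← ex]
    rcases hbs with hb | hb
    · refine ⟨1 / 2, by norm_num, by norm_num, ?_⟩
      have := congrArg GaussianInt.toComplex hb
      simp only [map_mul, map_pow, map_ofNat] at this
      push_cast
      linear_combination (1 / 2) * this
    · refine ⟨2, by norm_num, by norm_num, ?_⟩
      have := congrArg GaussianInt.toComplex hb
      simp only [map_mul, map_pow, map_ofNat] at this
      push_cast
      linear_combination this
  have hang := angle x c.re c.im s k (by exact_mod_cast hx1) hcb'
    (by rcases hs with rfl | rfl <;> simp) hk0 hk
  have hyR : (0 : ℝ) < y := by exact_mod_cast hy0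
  have hxR : (0 : ℝ) < x := by exact_mod_cast hx
  have hR : (x : ℝ) ^ 2 + 1 = 2 * y ^ 4 := by exact_mod_cast h
  have hs2 : (s : ℝ) ^ 2 = 1 := by rcases hs with rfl | rfl <;> norm_num
  set Y := Real.sqrt y with hYdef
  have hY0 : 0 < Y := Real.sqrt_pos.2 hyR
  have hYsq : Y ^ 2 = y := Real.sq_sqrt hyR.le
  set B := ‖((c.re : ℝ) : ℂ) + ((c.im : ℝ) : ℂ) * Complex.I‖ with hB
  have hBb : B ≤ 51 / 10 * Y := by
    have e := congrArg Complex.normSq hk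
    simp only [map_mul, map_pow, Complex.normSq_ofReal, Complex.normSq_add_mul_I] at e
    have e2 : Complex.normSq (239 - Complex.I) = 57122 := by
      rw [Complex.normSq_apply]; simp; norm_num
    have e3 : B ^ 2 = (c.re : ℝ) ^ 2 + (c.im : ℝ) ^ 2 := by
      rw [hB, Complex.sq_norm, Complex.normSq_add_mul_I]
    rw [e2, ← e3, hs2, hR] at e
    have e4 : (B ^ 2) ^ 4 ≤ (26 * (y : ℝ)) ^ 4 := by
      rw [e]
      have : k * k ≤ 4 := by nlinarith
      have hy4 : (0 : ℝ) < y ^ 4 := by positivity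
      nlinarith
    have e5 : B ^ 2 ≤ 26 * (y : ℝ) := le_of_pow_le_pow_left₀ (by norm_num) (by positivity) e4
    apply le_of_sq_le_sq _ (by positivity)
    rw [mul_pow, hYsq]
    linarith
  have hφ : |Real.arctan (s / x)| ≤ 1 / x := by
    have g : |(s : ℝ) / x| = 1 / x := by
      rw [abs_div, abs_of_pos hxR]
      rcases hs with rfl | rfl <;> simp
    rw [← g]
    exact abs_arctan_le _
  have h31 : (31 : ℝ) ^ 12 ≤ Y := by
    apply Real.le_sqrt_of_sq_le
    rw [← pow_mul]
    exact_mod_cast hy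
  obtain ⟨M, hM1, hM2⟩ := exists_nat_pow_near (show (1 : ℝ) ≤ Y from le_trans (by norm_num) h31)
    (show (1 : ℝ) < 31 by norm_num)
  have hM : 12 ≤ M := by
    have := (pow_lt_pow_iff_right₀ (show (1 : ℝ) < 31 by norm_num)).1 (h31.trans_lt hM2)
    omega
  have hxY : Y ^ 4 ≤ x := by
    rw [show Y ^ 4 = (Y ^ 2) ^ 2 by ring, hYsq]
    exact_mod_cast hxy
  have step (n : ℕ) (hn : n = M ∨ n = M + 1) :
      (8 ^ (n + 1) * p (n + 1) * (((c.re : ℝ) : ℂ) + ((c.im : ℝ) : ℂ) * Complex.I)).im = 0 := by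
    by_contra hne
    have l := lower (n + 1) c (by rw [hcc]; exact hne)
    rw [hcc] at l
    have u := upper (n + 1) c.re c.im hc0
    have ap := arctan_approx (1 / 239) (by norm_num) n
    have tt : |Real.arctan (S (1 / 239) (n + 1) / R (1 / 239) (n + 1)) +
        Real.arctan (c.im / c.re)| ≤ 25 / 16 * (1 / 239) ^ (2 * (n + 1) + 1) * (16 / 49) ^ (n + 1)
        + 1 / (4 * x) := by
      have e : Real.arctan (S (1 / 239) (n + 1) / R (1 / 239) (n + 1)) +
        Real.arctan (c.im / c.re) = (Real.arctan (S (1 / 239) (n + 1) / R (1 / 239) (n + 1))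
          - Real.arctan (1 / 239) / 4) + Real.arctan (s / x) / 4 := by linarith
      rw [e]
      refine (abs_add_le _ _).trans (add_le_add ap ?_)
      rw [abs_div, abs_of_pos (show (0 : ℝ) < 4 by norm_num)]
      calc |Real.arctan (s / x)| / 4 ≤ 1 / x / 4 := by gcongr
        _ = _ := by field_simp
    have nu := numeric M n Y x hM hM1 hM2 hxY hn
    have := calc (7 / 5 : ℝ) ^ (n + 1) / 2 ≤ _ := l
      _ ≤ _ := u
      _ ≤ 7656 ^ (n + 1) * (51 / 10 * Y) * (25 / 16 * (1 / 239) ^ (2 * (n + 1) + 1) *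
          (16 / 49) ^ (n + 1) + 1 / (4 * x)) := by gcongr
      _ < _ := nu
    exact lt_irrefl _ this
  exact nonvanish (M + 1) c.re c.im hc0 (step M (Or.inl rfl)) (step (M + 1) (Or.inr rfl))

end Ljunggren

/-- Ljunggren's equation: `x² − 2y⁴ = −1` has exactly two solutions in positive
integers, namely `(x, y) = (1, 1)` and `(x, y) = (239, 13)`. -/
theorem stmt_1 (x y : ℤ) (hx : 0 < x) (hy : 0 < y) :
    x ^ 2 - 2 * y ^ 4 = -1 ↔ (x = 1 ∧ y = 1) ∨ (x = 239 ∧ y = 13) := by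
  constructor
  · intro h
    have h' : x ^ 2 + 1 = 2 * y ^ 4 := by linarith
    rcases le_or_gt ((31 : ℤ) ^ 24) y with hl | hl
    · exact (Ljunggren.large x y hx hl h').elim
    · lift x to ℕ using hx.le
      lift y to ℕ using hy.le
      have := Ljunggren.small x y (by exact_mod_cast hy) (by exact_mod_cast h')
        (by exact_mod_cast hl)
      exact_mod_cast this
  · rintro (⟨rfl, rfl⟩ | ⟨rfl, rfl⟩) <;> norm_num
end

section
/- There are infinitely many primitive Pythagorean triples whose sum of legs is a perfect square; that is, the set of triples (x, y, z) of positive integers with x² + y² = z², gcd(x, y) = 1, and x + y a perfect square is infinite. -/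
/-- There are infinitely many primitive Pythagorean triples whose sum of legs is
a perfect square. -/
theorem stmt_4 :
    {p : ℕ × ℕ × ℕ | 0 < p.1 ∧ 0 < p.2.1 ∧ 0 < p.2.2 ∧
      p.1 ^ 2 + p.2.1 ^ 2 = p.2.2 ^ 2 ∧ Nat.gcd p.1 p.2.1 = 1 ∧
      ∃ f : ℕ, p.1 + p.2.1 = f ^ 2}.Infinite := by
  refine Set.infinite_of_injective_forall_mem (f := fun k : ℕ =>
    ((4*k^2+12*k+7)*(4*k^2+20*k+27), 2*(4*k^2+16*k+17)*(4*k+10),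
      (4*k^2+16*k+17)^2+(4*k+10)^2)) ?_ ?_
  · have hm : StrictMono (fun k : ℕ => (4*k^2+16*k+17)^2+(4*k+10)^2) := by
      intro a b h
      dsimp only
      gcongr
    intro a b h
    simp only [Prod.mk.injEq] at h
    exact hm.injective h.2.2
  · intro k
    refine ⟨by positivity, by positivity, by positivity, by dsimp only; ring, ?_,
      4*k^2+20*k+23, by dsimp only; ring⟩
    dsimp only
    refine Nat.isCoprime_iff_coprime.mp ?_
    push_cast
    generalize (k : ℤ) = t
    have h0 : IsCoprime (4*t^2+16*t+17) (4*t+10) :=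
      ⟨1-2*(t+2)^2, (t+2)^2*(2*t+3), by ring⟩
    have e : (4*t^2+12*t+7)*(4*t^2+20*t+27) = (4*t^2+16*t+17)^2 - (4*t+10)^2 := by ring
    rw [e]
    refine IsCoprime.mul_right (IsCoprime.mul_right ?_ ?_) ?_
    · exact ⟨1, -(((4*t^2+16*t+17)^2 - (4*t+10)^2 - 1)/2), by
        have : (4*t^2+16*t+17)^2 - (4*t+10)^2 - 1 =
          2 * (4*(t^2+4*t+4)*(2*(t^2+4*t+4)+1) - 2*(2*t+5)^2) := by ring
        omega⟩
    · obtain ⟨u, v, h⟩ := (h0.pow_right (n := 2))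
      exact ⟨-v, u + v*(4*t^2+16*t+17), by linear_combination h⟩
    · obtain ⟨u, v, h⟩ := (h0.pow_left (m := 2))
      exact ⟨u, v + u*(4*t+10), by linear_combination h⟩
end

section
/- If x and w are positive integers with x² + (x+1)² = w⁴, then there exist positive integers m > n with gcd(m, n) = 1 and m + n odd such that w² = m² + n² and m² − n² − 2mn = 1 or m² − n² − 2mn = −1; consequently (m+n)² − 2m² = −1 or (m+n)² − 2m² = 1. -/
lemma aux_13 (a b w : ℤ) (ha : 0 < a) (hb : 0 < b) (hw : 0 < w)
    (h : a ^ 2 + b ^ 2 = w ^ 4) (hab : a - b = 1 ∨ a - b = -1) (hodd : a % 2 = 1) :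
    ∃ m n : ℤ, 0 < n ∧ n < m ∧ Int.gcd m n = 1 ∧ Odd (m + n) ∧
      w ^ 2 = m ^ 2 + n ^ 2 ∧
      (m ^ 2 - n ^ 2 - 2 * m * n = 1 ∨ m ^ 2 - n ^ 2 - 2 * m * n = -1) ∧
      ((m + n) ^ 2 - 2 * m ^ 2 = -1 ∨ (m + n) ^ 2 - 2 * m ^ 2 = 1) := by
  have hp : PythagoreanTriple a b (w ^ 2) := by
    unfold PythagoreanTriple
    linear_combination h
  have hg : Int.gcd a b = 1 := by
    rw [← Int.isCoprime_iff_gcd_eq_one]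
    rcases hab with e | e
    · exact ⟨1, -1, by linarith⟩
    · exact ⟨-1, 1, by linarith⟩
  obtain ⟨m, n, h1, h2, h3, h4, h5, h6⟩ :=
    hp.coprime_classification' hg hodd (by positivity)
  have hmn : 0 < m * n := by nlinarith
  have hn : 0 < n := pos_of_mul_pos_right hmn h6
  refine ⟨m, n, hn, by nlinarith, h4, ?_, h3, ?_, ?_⟩
  · rw [Int.odd_iff]; omega
  · rcases hab with e | e
    · left; linarith
    · right; linarith
  · rcases hab with e | e
    · left; linarith
    · right; linarith

/-- If `x, w` are positive integers with `x² + (x+1)² = w⁴`, then there are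
coprime generators `m > n > 0` of opposite parity with `w² = m² + n²` and
`m² − n² − 2mn = ±1`; consequently `(m+n)² − 2m² = ∓1`. -/
theorem stmt_13 (x w : ℤ) (hx : 0 < x) (hw : 0 < w)
    (h : x ^ 2 + (x + 1) ^ 2 = w ^ 4) :
    ∃ m n : ℤ, 0 < n ∧ n < m ∧ Int.gcd m n = 1 ∧ Odd (m + n) ∧
      w ^ 2 = m ^ 2 + n ^ 2 ∧
      (m ^ 2 - n ^ 2 - 2 * m * n = 1 ∨ m ^ 2 - n ^ 2 - 2 * m * n = -1) ∧
      ((m + n) ^ 2 - 2 * m ^ 2 = -1 ∨ (m + n) ^ 2 - 2 * m ^ 2 = 1) := by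

  rcases Int.emod_two_eq_zero_or_one x with e | e
  · exact aux_13 (x + 1) x w (by omega) hx hw (by linarith) (by omega) (by omega)
  · exact aux_13 x (x + 1) w hx (by omega) hw h (by omega) e
end

section
/- Let a, b, c, d be rational numbers with c ≠ 0, d ≠ 0, d + c ≠ 0 and bc + ad ≠ 0. Define t₁ = ((ad² − bc²)² − (2cd(d+c))²) / (4cd(d+c)(bc + ad)), α = t₁ + (ad² − bc²)/(2d(d+c)), and β = t₁ − (ad² − bc²)/(2c(d+c)). Then t₁² + a·t₁ + c² = α² and t₁² + b·t₁ + d² = β²; in particular t₁ is a rational solution of the simultaneous equations t² + at + c² = α² and t² + bt + d² = β². -/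
/-- Fermat's method, first solution: with `t₁`, `α`, `β` as defined below,
`t₁² + a t₁ + c² = α²` and `t₁² + b t₁ + d² = β²`. -/
theorem stmt_14 (a b c d : ℚ) (hc : c ≠ 0) (hd : d ≠ 0) (hdc : d + c ≠ 0)
    (hba : b * c + a * d ≠ 0) :
    let t₁ := ((a * d ^ 2 - b * c ^ 2) ^ 2 - (2 * c * d * (d + c)) ^ 2) /
      (4 * c * d * (d + c) * (b * c + a * d))
    let α := t₁ + (a * d ^ 2 - b * c ^ 2) / (2 * d * (d + c))
    let β := t₁ - (a * d ^ 2 - b * c ^ 2) / (2 * c * (d + c))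
    t₁ ^ 2 + a * t₁ + c ^ 2 = α ^ 2 ∧ t₁ ^ 2 + b * t₁ + d ^ 2 = β ^ 2 := by
  intro t₁ α β
  constructor
  · simp only [α, t₁]
    field_simp
    ring
  · simp only [β, t₁]
    field_simp
    ring
end

section
/- Let a, b, c, d be rational numbers with c ≠ 0, d ≠ 0, d − c ≠ 0 and bc − ad ≠ 0. Define t₂ = ((ad² − bc²)² − (2cd(d−c))²) / (4cd(d−c)(bc − ad)), α = t₂ + (ad² − bc²)/(2d(d−c)), and β = t₂ + (ad² − bc²)/(2c(d−c)). Then t₂² + a·t₂ + c² = α² and t₂² + b·t₂ + d² = β²; in particular t₂ is a rational solution of the simultaneous equations t² + at + c² = α² and t² + bt + d² = β². -/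
/-- Fermat's method, second solution: with `t₂`, `α`, `β` as defined below,
`t₂² + a t₂ + c² = α²` and `t₂² + b t₂ + d² = β²`. -/
theorem stmt_15 (a b c d : ℚ) (hc : c ≠ 0) (hd : d ≠ 0) (hdc : d - c ≠ 0)
    (hba : b * c - a * d ≠ 0) :
    let t₂ := ((a * d ^ 2 - b * c ^ 2) ^ 2 - (2 * c * d * (d - c)) ^ 2) /
      (4 * c * d * (d - c) * (b * c - a * d))
    let α := t₂ + (a * d ^ 2 - b * c ^ 2) / (2 * d * (d - c))
    let β := t₂ + (a * d ^ 2 - b * c ^ 2) / (2 * c * (d - c))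
    t₂ ^ 2 + a * t₂ + c ^ 2 = α ^ 2 ∧ t₂ ^ 2 + b * t₂ + d ^ 2 = β ^ 2 := by
  intro t₂ α β
  constructor
  · simp only [α, t₂]
    field_simp
    ring
  · simp only [β, t₂]
    field_simp
    ring
end

section
/- Let a, b, c, d be rational numbers and suppose d = e² for some nonzero rational e with a + c/e ≠ 0. Define α = c/(2e), β = e, and T = (c²/(4d) − b − 2e)/(a + c/e). Then T⁴ + aT³ + bT² + cT + d = (T² − αT − β)²; in particular the quartic T⁴ + aT³ + bT² + cT + d takes a rational square value at the rational number T. -/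
/-- If the constant term `d` of the monic quartic `T⁴ + aT³ + bT² + cT + d` is a
square `e²` of a nonzero rational with `a + c/e ≠ 0`, then with `α = c/(2e)`,
`β = e` and `T = (c²/(4d) − b − 2e)/(a + c/e)`, the quartic equals
`(T² − αT − β)²` at `T`; in particular it takes a rational square value there. -/
theorem stmt_18 (a b c d e : ℚ) (he : e ≠ 0) (hd : d = e ^ 2)
    (h : a + c / e ≠ 0) :
    let α := c / (2 * e)
    let β := e
    let T := (c ^ 2 / (4 * d) - b - 2 * e) / (a + c / e)
    T ^ 4 + a * T ^ 3 + b * T ^ 2 + c * T + d = (T ^ 2 - α * T - β) ^ 2 := by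
  intro α β T
  have hT : T * (a + c / e) = c ^ 2 / (4 * d) - b - 2 * e := div_mul_cancel₀ _ h
  have h1 : c / e = 2 * α := by
    simp only [α]; field_simp
  have h2 : c ^ 2 / (4 * d) = α ^ 2 := by
    simp only [α, hd]; field_simp; norm_num
  have h3 : c = 2 * α * e := by
    simp only [α]; field_simp
  rw [h1, h2] at hT
  have hβ : β = e := rfl
  rw [hβ, hd]
  clear_value T α
  linear_combination T ^ 2 * hT + T * h3
end
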